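/- arXiv:1609.00132 — 13 statements merged into one kernel-verified Lean document; each statement's English description precedes it below -/
import Mathlib

section
/- In every C-set (S⊥, M), for all α, β ∈ M and s, t ∈ S⊥, the ∨-axiom holds: (α ∨ β)[s, t] = α[s, β[s, t]]. -/
universe u v

/-- A C-algebra (Guzmán–Squier): the algebra of McCarthy's three-valued conditional logic. -/
class CAlgebra (M : Type v) where
  cor : M → M → M
  cand : M → M → M
  cnot : M → M
  not_not : ∀ α, cnot (cnot α) = α
  not_and : ∀ α β, cnot (cand α β) = cor (cnot α) (cnot β)
  and_assoc : ∀ α β γ, cand (cand α β) γ = cand α (cand β γ)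
  and_or_distrib : ∀ α β γ, cand α (cor β γ) = cor (cand α β) (cand α γ)
  or_and : ∀ α β γ, cand (cor α β) γ = cor (cand α γ) (cand (cnot α) (cand β γ))
  absorb : ∀ α β, cor α (cand α β) = α
  quasi_comm : ∀ α β, cor (cand α β) (cand β α) = cor (cand β α) (cand α β)

/-- A C-algebra with constants T, F, U. -/
class CAlgebraTFU (M : Type v) extends CAlgebra M where
  T : M
  F : M
  U : M
  T_and : ∀ α, cand T α = α
  and_T : ∀ α, cand α T = α
  F_or : ∀ α, cor F α = α
  or_F : ∀ α, cor α F = α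
  not_U : cnot U = U
  U_and : ∀ α, cand U α = U
  U_or : ∀ α, cor U α = U
  F_and : ∀ α, cand F α = F

/-- A C-set: a pointed set with an if-then-else action of a C-algebra with T, F, U. -/
class CSet (S : Type u) (M : Type v) [CAlgebraTFU M] where
  bot : S
  act : M → S → S → S
  U_ax : ∀ s t, act CAlgebraTFU.U s t = bot
  F_ax : ∀ s t, act CAlgebraTFU.F s t = t
  not_ax : ∀ α s t, act (CAlgebra.cnot α) s t = act α t s
  pos_red : ∀ α s t u, act α (act α s t) u = act α s u
  neg_red : ∀ α s t u, act α s (act α t u) = act α s u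
  and_ax : ∀ α β s t, act (CAlgebra.cand α β) s t = act α (act β s t) t
  interchange : ∀ α β s t u v,
    act α (act β s t) (act β u v) = act β (act α s u) (act α t v)
  and_compat : ∀ α β s t, act α s t = act α t t →
    act (CAlgebra.cand α β) s t = act (CAlgebra.cand α β) t t

/-- In every C-set, the ∨-axiom holds: (α ∨ β)[s, t] = α[s, β[s, t]]. -/
theorem vee_axiom (S : Type u) (M : Type v) [CAlgebraTFU M] [CSet S M]
    (α β : M) (s t : S) :
    CSet.act (CAlgebra.cor α β) s t = CSet.act α s (CSet.act β s t) := by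
  have h : CAlgebra.cor α β
      = CAlgebra.cnot (CAlgebra.cand (CAlgebra.cnot α) (CAlgebra.cnot β)) := by
    rw [CAlgebra.not_and, CAlgebra.not_not, CAlgebra.not_not]
  rw [h, CSet.not_ax, CSet.and_ax, CSet.not_ax, CSet.not_ax]
end

section
/- In every C-set (S⊥, M), for every α ∈ M with α ∨ ¬α = T (i.e., α ∈ M_#) and every s ∈ S⊥, one has α[s, s] = s. -/
universe u v

/-- For α ∈ M_# (i.e. α ∨ ¬α = T) and any s, α[s, s] = s. -/
theorem act_diag_of_mem_sharp (S : Type u) (M : Type v) [CAlgebraTFU M] [CSet S M]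
    (α : M) (hα : CAlgebra.cor α (CAlgebra.cnot α) = CAlgebraTFU.T) (s : S) :
    CSet.act α s s = s := by
  have hF : CAlgebra.cnot (CAlgebraTFU.F : M) = CAlgebraTFU.T := by
    have h := CAlgebra.not_and (CAlgebra.cnot (CAlgebraTFU.F : M)) CAlgebraTFU.T
    rw [CAlgebraTFU.and_T, CAlgebra.not_not, CAlgebraTFU.F_or] at h
    rw [h, CAlgebra.not_not]
  have h1 : CAlgebra.cand (CAlgebra.cnot α) α = CAlgebraTFU.F := by
    have h := CAlgebra.not_and (CAlgebra.cnot α) α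
    rw [CAlgebra.not_not, hα, ← hF] at h
    have h2 := congrArg CAlgebra.cnot h
    rwa [CAlgebra.not_not, CAlgebra.not_not] at h2
  have h2 := CSet.and_ax (CAlgebra.cnot α) α s s
  rw [h1, CSet.F_ax, CSet.not_ax, CSet.neg_red] at h2
  exact h2.symm
end

section
/- For every C-set (S⊥, M), the pair (S⊥, M_#) with the restricted action is a B-set; that is, for all α, β ∈ M_# and a, b, c ∈ S⊥ the B-set axioms hold: α[a,a] = a; α[α[a,b], c] = α[a,c]; α[a, α[b,c]] = α[a,c]; F[a,b] = b; (¬α)[a,b] = α[b,a]; (α ∧ β)[a,b] = α[β[a,b], b]. -/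
universe u v

/-- For every C-set (S⊥, M), the pair (S⊥, M_#) with the restricted action
is a B-set: all six B-set axioms hold for α, β ∈ M_# and a, b, c ∈ S⊥. -/
theorem sharp_is_BSet (S : Type u) (M : Type v) [CAlgebraTFU M] [CSet S M]
    (α β : M) (hα : CAlgebra.cor α (CAlgebra.cnot α) = CAlgebraTFU.T)
    (hβ : CAlgebra.cor β (CAlgebra.cnot β) = CAlgebraTFU.T) (a b c : S) :
    CSet.act α a a = a ∧
    CSet.act α (CSet.act α a b) c = CSet.act α a c ∧
    CSet.act α a (CSet.act α b c) = CSet.act α a c ∧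
    CSet.act (CAlgebraTFU.F : M) a b = b ∧
    CSet.act (CAlgebra.cnot α) a b = CSet.act α b a ∧
    CSet.act (CAlgebra.cand α β) a b = CSet.act α (CSet.act β a b) b := by
  have hT : (CAlgebraTFU.T : M) = CAlgebra.cnot CAlgebraTFU.F := by
    have h1 := CAlgebraTFU.and_T (CAlgebra.cnot (CAlgebraTFU.F : M))
    rw [← CAlgebra.not_not (CAlgebra.cand _ _), CAlgebra.not_and, CAlgebra.not_not,
      CAlgebraTFU.F_or, CAlgebra.not_not] at h1
    exact h1
  have hact : CSet.act (CAlgebraTFU.T : M) a a = a := by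
    rw [hT, CSet.not_ax, CSet.F_ax]
  have hN : CAlgebra.cnot (CAlgebra.cand (CAlgebra.cnot α) α) = CAlgebraTFU.T := by
    rw [CAlgebra.not_and, CAlgebra.not_not, hα]
  refine ⟨?_, CSet.pos_red α a b c, CSet.neg_red α a b c, CSet.F_ax a b,
    CSet.not_ax α a b, CSet.and_ax α β a b⟩
  rw [← hN, CSet.not_ax, CSet.and_ax, CSet.not_ax, CSet.neg_red] at hact
  exact hact
end

section
/- Let (S⊥, M) be a C-set where M is an ada. For all α ∈ M and s, t ∈ S⊥: if α[s, t] = α[t, t], then α↓[s, t] = α↓[t, t]. -/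
universe u v

/-- An ada (algebra of disjoint alternatives): a C-algebra with T, F, U with a unary
operation `down` (written α↓). -/
class Ada (M : Type v) extends CAlgebraTFU M where
  down : M → M
  down_F : down F = F
  down_U : down U = F
  down_T : down T = T
  down_and : ∀ α β, cand α (down β) = cand α (down (cand α β))
  down_or_not : ∀ α, cor (down α) (cnot (down α)) = T
  down_or : ∀ α, α = cor (down α) α

/-- In a C-set over an ada, if α[s, t] = α[t, t] then α↓[s, t] = α↓[t, t]. -/
theorem down_compat_act (S : Type u) (M : Type v) [Ada M] [CSet S M]
    (α : M) (s t : S) (h : CSet.act α s t = CSet.act α t t) :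
    CSet.act (Ada.down α) s t = CSet.act (Ada.down α) t t := by
  have key : ∀ x y : S, CSet.act α x y = CSet.act (Ada.down α) x (CSet.act α x y) := by
    intro x y
    have h1 : α = CAlgebra.cnot (CAlgebra.cand (CAlgebra.cnot (Ada.down α)) (CAlgebra.cnot α)) := by
      rw [CAlgebra.not_and, CAlgebra.not_not, CAlgebra.not_not]
      exact Ada.down_or α
    conv_lhs => rw [h1]
    rw [CSet.not_ax, CSet.and_ax, CSet.not_ax, CSet.not_ax]
  have k2 : ∀ x y z : S,
      CSet.act (Ada.down α) (CSet.act α x y) z = CSet.act (Ada.down α) x z := by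
    intro x y z
    rw [key x y, CSet.pos_red]
  rw [← k2 s t t, h, k2]
end

section
/- Let (S⊥, M) be a C-set where M is an ada and let θ be a maximal congruence on M. Then the relation E_θ = {(s,t) ∈ S⊥ × S⊥ : β[s,t] = β[t,t] for some β ∈ M with (β, T) ∈ θ} is an equivalence relation on S⊥. -/
universe u v

/-- A congruence on an ada: an equivalence relation compatible with all the operations. -/
structure AdaCongruence (M : Type v) [Ada M] where
  rel : M → M → Prop
  refl : ∀ α, rel α α
  symm : ∀ {α β}, rel α β → rel β α
  trans : ∀ {α β γ}, rel α β → rel β γ → rel α γ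
  or_compat : ∀ {α β γ δ}, rel α β → rel γ δ → rel (CAlgebra.cor α γ) (CAlgebra.cor β δ)
  and_compat : ∀ {α β γ δ}, rel α β → rel γ δ → rel (CAlgebra.cand α γ) (CAlgebra.cand β δ)
  not_compat : ∀ {α β}, rel α β → rel (CAlgebra.cnot α) (CAlgebra.cnot β)
  down_compat : ∀ {α β}, rel α β → rel (Ada.down α) (Ada.down β)

/-- A congruence θ on an ada is maximal iff the quotient M/θ is isomorphic to the
three-element ada 3 = {T, F, U}: the classes of T, F, U are pairwise distinct and
every element is related to one of T, F, U. -/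
def AdaCongruence.IsMaximal {M : Type v} [Ada M] (θ : AdaCongruence M) : Prop :=
  ¬ θ.rel CAlgebraTFU.T CAlgebraTFU.F ∧ ¬ θ.rel CAlgebraTFU.T CAlgebraTFU.U ∧
  ¬ θ.rel CAlgebraTFU.F CAlgebraTFU.U ∧
  ∀ α : M, θ.rel α CAlgebraTFU.T ∨ θ.rel α CAlgebraTFU.F ∨ θ.rel α CAlgebraTFU.U

/-- The relation E_θ on S⊥: s E_θ t iff β[s,t] = β[t,t] for some β with (β, T) ∈ θ. -/
def Erel (S : Type u) (M : Type v) [CAlgebraTFU M] [CSet S M]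
    (θrel : M → M → Prop) (s t : S) : Prop :=
  ∃ β : M, θrel β CAlgebraTFU.T ∧ CSet.act β s t = CSet.act β t t

/-- For a C-set over an ada and a maximal congruence θ on M,
the relation E_θ is an equivalence relation on S⊥. -/
theorem Erel_equivalence (S : Type u) (M : Type v) [Ada M] [CSet S M]
    (θ : AdaCongruence M) (hθ : θ.IsMaximal) :
    Equivalence (Erel S M θ.rel) := by
  have key : ∀ (β : M) (s t u : S), CSet.act β s t = CSet.act β t t →
      CSet.act β s u = CSet.act β t u := by
    intro β s t u h
    rw [← CSet.pos_red β s t u, h, CSet.pos_red]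
  refine ⟨fun s => ⟨CAlgebraTFU.T, θ.refl _, rfl⟩, ?_, ?_⟩
  · rintro s t ⟨β, hβ, h⟩
    exact ⟨β, hβ, (key β s t s h).symm⟩
  · rintro s t r ⟨β, hβ, h⟩ ⟨γ, hγ, h'⟩
    refine ⟨CAlgebra.cand β γ, ?_, ?_⟩
    · have := θ.and_compat hβ hγ
      rwa [CAlgebraTFU.T_and] at this
    · rw [key _ s t r (CSet.and_compat β γ s t h), CSet.and_ax, CSet.and_ax, h']
end

section
/- Let M be an ada. For any α ∈ M, the element β = ¬(α↓ ∨ (¬α)↓) ∨ U satisfies β ∧ α = U. Moreover, for any congruence θ on M, if (α, U) ∈ θ then (β, T) ∈ θ. -/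
universe u v

section AdaHelpers
open CAlgebra CAlgebraTFU Ada
variable {M : Type v}

theorem aux_not_or [CAlgebra M] (x y : M) : cnot (cor x y) = cand (cnot x) (cnot y) := by
  have h := CAlgebra.not_and (cnot x) (cnot y)
  rw [CAlgebra.not_not, CAlgebra.not_not] at h
  rw [← h, CAlgebra.not_not]

theorem aux_not_F [CAlgebraTFU M] : cnot (F : M) = T := by
  have h := CAlgebra.not_and (T : M) (cnot F)
  rw [CAlgebra.not_not, or_F, T_and, CAlgebra.not_not] at h
  rw [h, CAlgebra.not_not]

theorem aux_not_T [CAlgebraTFU M] : cnot (T : M) = F := by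
  rw [← aux_not_F, CAlgebra.not_not]

theorem aux_or [CAlgebraTFU M] (x y : M) : cor x (cand (cnot x) y) = cor x y := by
  have h := or_and x y T
  rw [and_T, and_T, and_T] at h
  exact h.symm

theorem aux_and [CAlgebraTFU M] (x y : M) : cand x (cor (cnot x) y) = cand x y := by
  have h := congrArg cnot (aux_or (cnot x) (cnot y))
  simpa only [aux_not_or, CAlgebra.not_and, CAlgebra.not_not] using h

theorem aux_idem [CAlgebraTFU M] (x : M) : cand x x = x := by
  have h := congrArg cnot (absorb (cnot x) T)
  rw [and_T, aux_not_or, CAlgebra.not_not] at h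
  exact h

theorem aux_and_not [CAlgebraTFU M] (x : M) (h : cand x F = F) : cand x (cnot x) = F := by
  rw [← aux_and x F, or_F] at h
  exact h

theorem aux_not_down_F [Ada M] (x : M) : cand (cnot (down x)) F = F := by
  have h := congrArg cnot (down_or_not x)
  rw [aux_not_or, CAlgebra.not_not, aux_not_T] at h
  have h2 := aux_and (cnot (down x)) F
  rw [CAlgebra.not_not, or_F] at h2
  rw [← h2, h]

theorem aux_down_F [Ada M] (x : M) : cand (down x) F = F := by
  have h := or_and (down x) (cnot (down x)) F
  rw [down_or_not, T_and, aux_not_down_F, aux_not_down_F, or_F] at h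
  exact h.symm

theorem aux_self_down [Ada M] (x : M) : cand x (down x) = x := by
  have h := down_and x T
  rw [down_T, and_T] at h
  exact h.symm

/-- If `c` is Boolean and disjoint from `a↓`, then `c ∧ a = c ∧ a ∧ U`. -/
theorem aux_key [Ada M] (c a : M) (h1 : cand c F = F) (h2 : cand (cnot c) F = F)
    (h : cand c (down a) = F) : cand c (cand a U) = cand c a := by
  have e1 : cand c (cnot c) = F := aux_and_not c h1
  have e2 : cand (cnot c) c = F := by
    have := aux_and_not (cnot c) h2
    rwa [CAlgebra.not_not] at this
  have e3 : cor c (cnot c) = T := by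
    have := congrArg cnot e2
    rwa [CAlgebra.not_and, CAlgebra.not_not, aux_not_F] at this
  obtain ⟨δ, hδ⟩ : ∃ δ, δ = cor (cand c a) (cand (cnot c) U) := ⟨_, rfl⟩
  have k1 : cand c δ = cand c a := by
    rw [hδ, and_or_distrib, ← CAlgebra.and_assoc, ← CAlgebra.and_assoc, aux_idem, e1, F_and, or_F]
  have k2 : cand (cnot c) δ = cand (cnot c) U := by
    rw [hδ, and_or_distrib, ← CAlgebra.and_assoc, ← CAlgebra.and_assoc, aux_idem, e2, F_and, F_or]
  have k3 : cand c (down δ) = F := by rw [down_and, k1, ← down_and, h]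
  have k4 : cand (cnot c) (down δ) = F := by rw [down_and, k2, ← down_and, down_U, h2]
  have k5 : down δ = F := by
    have := or_and c (cnot c) (down δ)
    rw [e3, T_and, k3, k4, h2, or_F] at this
    exact this
  have k6 : cand δ F = δ := by
    have := aux_self_down δ
    rwa [k5] at this
  have k7 : cand δ U = δ := by
    rw [← k6, CAlgebra.and_assoc, F_and]
  rw [← CAlgebra.and_assoc, ← k1, CAlgebra.and_assoc, k7]

theorem aux_main [Ada M] (a c : M) (hc : c = cnot (cor (down a) (down (cnot a)))) :
    cand (cor c U) a = U := by
  have hc1 : c = cand (cnot (down a)) (cnot (down (cnot a))) := by rw [hc, aux_not_or]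
  have hc2 : cnot c = cor (down a) (down (cnot a)) := by rw [hc, CAlgebra.not_not]
  have h1 : cand c F = F := by
    rw [hc1, CAlgebra.and_assoc, aux_not_down_F, aux_not_down_F]
  have h2 : cand (cnot c) F = F := by
    rw [hc2, or_and, aux_down_F, aux_down_F, aux_not_down_F, or_F]
  have e1 : cand c (cnot c) = F := aux_and_not c h1
  have e2 : cand (cnot c) c = F := by
    have := aux_and_not (cnot c) h2
    rwa [CAlgebra.not_not] at this
  have e3 : cor c (cnot c) = T := by
    have := congrArg cnot e2
    rwa [CAlgebra.not_and, CAlgebra.not_not, aux_not_F] at this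
  have h4 : cand c (down (cnot a)) = F := by
    have := aux_and_not _ (aux_not_down_F (cnot a))
    rw [CAlgebra.not_not] at this
    rw [hc1, CAlgebra.and_assoc, this, aux_not_down_F]
  have h3 : cand c (down a) = F := by
    rw [hc2, and_or_distrib, h4, or_F] at e1
    exact e1
  have k1 := aux_key c a h1 h2 h3
  have k2 := aux_key c (cnot a) h1 h2 h4
  have k3 : cand c (cor a U) = cand c a := by
    have := congrArg (fun z => cand c (cnot z)) k2
    simpa only [CAlgebra.not_and, CAlgebra.not_not, not_U, aux_and] using this
  have k4 : cand c U = cand c a := by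
    have := congrArg (cand c) (quasi_comm a U)
    rw [U_and, U_or, and_or_distrib, k1, ← and_or_distrib, k3] at this
    exact this.symm
  have k5 := or_and c (cnot c) (U : M)
  rw [e3, T_and, ← CAlgebra.and_assoc, aux_idem] at k5
  rw [or_and, U_and, ← k4, ← k5]

end AdaHelpers

/-- In an ada, β = ¬(α↓ ∨ (¬α)↓) ∨ U satisfies β ∧ α = U; moreover, for any
congruence θ on M, if (α, U) ∈ θ then (β, T) ∈ θ. -/
theorem beta_and_alpha_eq_U (M : Type v) [Ada M] (α : M) :
    CAlgebra.cand
      (CAlgebra.cor (CAlgebra.cnot (CAlgebra.cor (Ada.down α) (Ada.down (CAlgebra.cnot α))))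
        CAlgebraTFU.U) α = CAlgebraTFU.U ∧
    ∀ θ : AdaCongruence M, θ.rel α CAlgebraTFU.U →
      θ.rel
        (CAlgebra.cor (CAlgebra.cnot (CAlgebra.cor (Ada.down α) (Ada.down (CAlgebra.cnot α))))
          CAlgebraTFU.U) CAlgebraTFU.T := by
  refine ⟨aux_main α _ rfl, fun θ h => ?_⟩
  have h1 := θ.down_compat h
  have h2 := θ.down_compat (θ.not_compat h)
  have h3 := θ.or_compat (θ.not_compat (θ.or_compat h1 h2)) (θ.refl CAlgebraTFU.U)
  have e : CAlgebra.cor (CAlgebraTFU.T : M) CAlgebraTFU.U = CAlgebraTFU.T := by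
    rw [← aux_or, aux_not_T, CAlgebraTFU.F_and, CAlgebraTFU.or_F]
  rw [CAlgebraTFU.not_U, Ada.down_U, CAlgebraTFU.F_or, aux_not_F, e] at h3
  exact h3
end

section
/- Let (S⊥, M) be a C-set where M is an ada, let θ be a maximal congruence on M, and let E_θ = {(s,t) ∈ S⊥ × S⊥ : β[s,t] = β[t,t] for some β ∈ M with (β, T) ∈ θ}. Then for each α ∈ M and each s, t ∈ S⊥: (i) if (α, T) ∈ θ then (α[s,t], s) ∈ E_θ; (ii) if (α, F) ∈ θ then (α[s,t], t) ∈ E_θ; (iii) if (α, U) ∈ θ then (α[s,t], ⊥) ∈ E_θ. -/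
universe u v

namespace CProof
open CAlgebra CAlgebraTFU

section
variable {M : Type v} [CAlgebraTFU M]

theorem not_inj {a b : M} (h : cnot a = cnot b) : a = b := by
  rw [← CAlgebra.not_not a, h, CAlgebra.not_not]

theorem not_or (a b : M) : cnot (cor a b) = cand (cnot a) (cnot b) := by
  apply not_inj
  rw [CAlgebra.not_and, CAlgebra.not_not, CAlgebra.not_not, CAlgebra.not_not]

theorem not_T : cnot (T : M) = F := by
  have h := not_or (F : M) (cnot T)
  rw [F_or, CAlgebra.not_not] at h
  have h2 := and_T (cnot (F : M))
  rw [h2] at h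
  rw [h, CAlgebra.not_not]

theorem not_F : cnot (F : M) = T := by
  rw [← not_T, CAlgebra.not_not]

theorem or_assoc (a b c : M) : cor (cor a b) c = cor a (cor b c) := by
  apply not_inj
  simp only [not_or, CAlgebra.and_assoc]

theorem or_self (a : M) : cor a a = a := by
  have := absorb a T
  rwa [and_T] at this

theorem or_red (a b : M) : cor a (cand (cnot a) b) = cor a b := by
  have := or_and a b T
  simpa only [and_T] using this.symm

theorem and_red (a b : M) : cand a (cor (cnot a) b) = cand a b := by
  apply not_inj
  simp only [CAlgebra.not_and, not_or]
  exact or_red _ _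

theorem and_F (a : M) : cand a (cnot a) = cand a F := by
  have := and_red a F
  rwa [or_F] at this

theorem and_F_aux (a : M) :
    cor (cand a F) (cand (cnot a) F) = cand a F := by
  have h1 : cor (cand a F) (cand (cnot a) F) = cor (cand (cnot a) F) (cand a F) := by
    have h := quasi_comm a (cnot a)
    have h2 := and_F (cnot a)
    rw [CAlgebra.not_not] at h2
    rwa [and_F, h2] at h
  have h2 : cand (cnot (cand a F)) F = cor (cand (cnot a) F) (cand a F) := by
    rw [CAlgebra.not_and, not_F, or_and, T_and, CAlgebra.not_not]
  have h3 := or_red (cand a F) F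
  rw [or_F, h2, ← h1, ← or_assoc, or_self] at h3
  exact h3

theorem F_swap (a : M) : cand (cnot a) F = cand a F := by
  have h1 := and_F_aux a
  have h2 := and_F_aux (cnot a)
  rw [CAlgebra.not_not] at h2
  have h := quasi_comm a (cnot a)
  have h3 := and_F (cnot a)
  rw [CAlgebra.not_not] at h3
  rw [and_F, h3, h1, h2] at h
  exact h.symm

theorem pq_not_p (p q : M) :
    cand (cand p q) (cnot p) = cand (cand p q) F := by
  have h1 := and_F (cand p q)
  rw [CAlgebra.not_and, and_or_distrib] at h1
  have h2 : cand (cand p q) (cnot q) = cand (cand p q) F := by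
    rw [CAlgebra.and_assoc, and_F, ← CAlgebra.and_assoc]
  rw [h2, ← and_or_distrib, or_F] at h1
  exact h1

theorem or_U (a : M) : cor (cand a U) U = U := by
  have h := quasi_comm a U
  rwa [U_and, U_or] at h

theorem key {b a : M} (h1 : cand b a = cand (cand b a) F)
    (h2 : cand b (cnot a) = cand (cand b (cnot a)) F) : cand b a = cand b U := by
  have h3 : cand b a = cand b (cnot a) := by
    rw [h1, h2, CAlgebra.and_assoc, CAlgebra.and_assoc, F_swap]
  have h4 : cand b (cand a U) = cand b a := by
    rw [← CAlgebra.and_assoc, h1, CAlgebra.and_assoc, F_and]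
  have h5 : cand b U = cand b (cnot (cand a U)) := by
    conv_lhs => rw [← or_U a]
    rw [and_or_distrib, h4, h3, ← and_or_distrib, CAlgebra.not_and, not_U]
  have h6 : ∀ x : M, cand b (cnot x) = cand b (cnot (cand b x)) := by
    intro x
    rw [CAlgebra.not_and, and_red]
  rw [h5, h6, h4, ← h6, h3]

end

theorem and_down {M : Type v} [Ada M] (a : M) : cand a (Ada.down a) = a := by
  have h := Ada.down_and a T
  rw [Ada.down_T, and_T] at h
  exact h.symm

theorem ada_key {M : Type v} [Ada M] (a : M) :
    cand (cand (cnot (Ada.down a)) (cnot (Ada.down (cnot a)))) a =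
    cand (cand (cnot (Ada.down a)) (cnot (Ada.down (cnot a)))) U := by
  apply key
  · have h := pq_not_p (cnot (Ada.down a)) (cand (cnot (Ada.down (cnot a))) a)
    rw [CAlgebra.not_not] at h
    simp only [CAlgebra.and_assoc, and_down] at h ⊢
    exact h
  · have h := pq_not_p (cnot (Ada.down (cnot a))) (cnot a)
    rw [CAlgebra.not_not] at h
    simp only [CAlgebra.and_assoc, and_down] at h ⊢
    rw [← h]

end CProof

/-- For a C-set over an ada and a maximal congruence θ on M:
(i) (α,T) ∈ θ implies (α[s,t], s) ∈ E_θ; (ii) (α,F) ∈ θ implies (α[s,t], t) ∈ E_θ;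
(iii) (α,U) ∈ θ implies (α[s,t], ⊥) ∈ E_θ. -/
theorem Erel_act_cases (S : Type u) (M : Type v) [Ada M] [CSet S M]
    (θ : AdaCongruence M) (hθ : θ.IsMaximal) (α : M) (s t : S) :
    (θ.rel α CAlgebraTFU.T → Erel S M θ.rel (CSet.act α s t) s) ∧
    (θ.rel α CAlgebraTFU.F → Erel S M θ.rel (CSet.act α s t) t) ∧
    (θ.rel α CAlgebraTFU.U → Erel S M θ.rel (CSet.act α s t) (CSet.bot (S := S) (M := M))) := by
  refine ⟨fun h => ⟨α, h, CSet.pos_red _ _ _ _⟩, fun h => ⟨CAlgebra.cnot α, ?_, ?_⟩,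
    fun h => ⟨CAlgebra.cand (CAlgebra.cnot (Ada.down α))
      (CAlgebra.cnot (Ada.down (CAlgebra.cnot α))), ?_, ?_⟩⟩
  · have := θ.not_compat h
    rwa [CProof.not_F] at this
  · rw [CSet.not_ax, CSet.not_ax, CSet.neg_red]
  · have h1 := θ.not_compat (θ.down_compat h)
    have h2 := θ.not_compat (θ.down_compat (θ.not_compat h))
    rw [CAlgebraTFU.not_U] at h2
    rw [Ada.down_U, CProof.not_F] at h1 h2
    have h3 := θ.and_compat h1 h2
    rwa [CAlgebraTFU.T_and] at h3
  · have hk := CProof.ada_key α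
    generalize CAlgebra.cand (CAlgebra.cnot (Ada.down α))
      (CAlgebra.cnot (Ada.down (CAlgebra.cnot α))) = β at hk
    have h1 := CSet.and_ax β α s t
    rw [hk, CSet.and_ax, CSet.U_ax] at h1
    rw [← CSet.pos_red β (CSet.act α s t) t, ← h1, CSet.pos_red]
end

section
/- Let (S⊥, M) be a C-set where M is an ada and let θ be a maximal congruence on M. Then the pair (E_θ, θ), where E_θ = {(s,t) ∈ S⊥ × S⊥ : β[s,t] = β[t,t] for some β ∈ M with (β, T) ∈ θ}, is a C-set congruence on (S⊥, M). -/
universe u v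

section CHelpers
open CAlgebra CAlgebraTFU

theorem ch_not_or {M : Type v} [CAlgebra M] (a b : M) :
    cnot (cor a b) = cand (cnot a) (cnot b) := by
  rw [← CAlgebra.not_not (cand (cnot a) (cnot b)), CAlgebra.not_and, CAlgebra.not_not, CAlgebra.not_not]

theorem ch_not_F {M : Type v} [CAlgebraTFU M] : cnot (F : M) = T := by
  have h := ch_not_or (F : M) (cnot T)
  rw [F_or, CAlgebra.not_not, and_T] at h
  exact h.symm

theorem ch_not_T {M : Type v} [CAlgebraTFU M] : cnot (T : M) = F := by
  rw [← ch_not_F, CAlgebra.not_not]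

theorem ch_or_not_and {M : Type v} [CAlgebraTFU M] (a b : M) :
    cor a (cand (cnot a) b) = cor a b := by
  have h := CAlgebra.or_and a b T
  rw [and_T, and_T, and_T] at h
  exact h.symm

theorem ch_and_not_or {M : Type v} [CAlgebraTFU M] (a b : M) :
    cand a (cor (cnot a) b) = cand a b := by
  have h := congrArg cnot (ch_or_not_and (cnot a) (cnot b))
  rw [ch_not_or, ch_not_or, CAlgebra.not_and, CAlgebra.not_not, CAlgebra.not_not] at h
  exact h

theorem ch_and_absorb {M : Type v} [CAlgebra M] (a b : M) : cand a (cor a b) = a := by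
  have h := congrArg cnot (CAlgebra.absorb (cnot a) (cnot b))
  rw [ch_not_or, CAlgebra.not_and, CAlgebra.not_not, CAlgebra.not_not] at h
  exact h

theorem ch_and_not {M : Type v} [CAlgebraTFU M] (a : M) : cand a (cnot a) = cand a F := by
  have h := ch_and_not_or a F
  rwa [or_F] at h

theorem ch_or_not {M : Type v} [CAlgebraTFU M] (a : M) : cor a (cnot a) = cor a T := by
  have h := ch_or_not_and a T
  rwa [and_T] at h

theorem ch_idem {M : Type v} [CAlgebraTFU M] (a : M) : cand a a = a := by
  have h := ch_and_absorb a F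
  rwa [or_F] at h

theorem ch_xyx {M : Type v} [CAlgebraTFU M] (a b : M) :
    cand (cand a b) a = cand a b := by
  -- `a b (¬a) = a b F`
  have h1 : cand (cand a b) (cnot a) = cand (cand a b) F := by
    have h := ch_and_not (cand a b)
    rw [CAlgebra.not_and, CAlgebra.and_or_distrib, CAlgebra.and_assoc a b (cnot b), ch_and_not, ← CAlgebra.and_assoc,
      ← CAlgebra.and_or_distrib, or_F] at h
    exact h
  -- `a b = a b (a ∨ T)`
  have h2 : cand (cand a b) (cor a T) = cand a b := by
    have hq := congrArg (cand a) (CAlgebra.quasi_comm a b)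
    rw [CAlgebra.and_or_distrib, CAlgebra.and_or_distrib, ← CAlgebra.and_assoc, ← CAlgebra.and_assoc a b a, ch_idem, CAlgebra.absorb] at hq
    rw [CAlgebra.and_or_distrib, and_T]
    exact hq.symm
  rw [← ch_or_not, CAlgebra.and_or_distrib, h1, ← CAlgebra.and_or_distrib, or_F] at h2
  exact h2

theorem ch_and_not_rel {M : Type v} [CAlgebraTFU M] (g z : M) :
    cand g (cnot (cand g z)) = cand g (cnot z) := by
  rw [CAlgebra.not_and, ch_and_not_or]

/-- Relative uniqueness of the fixed point of negation. -/
theorem ch_rel_U {M : Type v} [CAlgebraTFU M] (g a : M)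
    (h1 : cand g a = cand g (cand a F)) (h2 : cand g (cnot a) = cand g (cand (cnot a) F)) :
    cand g a = cand g U := by
  have key : ∀ x : M, cand g x = cand g (cand x F) →
      cand g (cnot x) = cand g (cand (cnot x) F) →
      cand g x = cand g (cor (cand x F) (cand (cnot x) F)) := by
    intro x hx hy
    have e : cand g x = cand g (cor x T) := by
      have h := ch_and_not_rel g (cnot x)
      rw [hy, ch_and_not_rel, CAlgebra.not_and, CAlgebra.not_not, ch_not_F] at h
      exact h.symm
    have e2 := hx
    rw [← CAlgebra.and_assoc, e, CAlgebra.and_assoc, CAlgebra.or_and, T_and] at e2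
    rw [e, e2]
  have hA := key a h1 h2
  have hB := key (cnot a) h2 (by rw [CAlgebra.not_not]; exact h1)
  have hAB : cand g a = cand g (cnot a) := by
    rw [hA, hB, CAlgebra.not_not, ← ch_and_not a]
    have := CAlgebra.quasi_comm a (cnot a)
    have h' := ch_and_not (cnot a)
    rw [CAlgebra.not_not] at h'
    rw [← h', this]
  have hor : ∀ x : M, cand g x = cand g (cnot x) → cand g (cor x U) = cand g x := by
    intro x hx
    rw [← ch_or_not_and, CAlgebra.and_or_distrib, ← CAlgebra.and_assoc, ← hx, CAlgebra.absorb]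
  have o1 := hor a hAB
  have o2 := hor (cnot a) (by rw [CAlgebra.not_not]; exact hAB.symm)
  have o3 : cand g (cand a U) = cand g a := by
    have h := ch_and_not_rel g (cor (cnot a) U)
    rw [o2, ch_and_not_rel, ch_not_or, CAlgebra.not_not, not_U] at h
    exact h.symm
  have hU : cor (cand a U) U = (U : M) := by
    have h := CAlgebra.quasi_comm a (U : M)
    rwa [U_and, U_or] at h
  calc cand g a = cor (cand g a) (cand g U) := by rw [← CAlgebra.and_or_distrib, o1]
    _ = cand g (cor (cand a U) U) := by rw [CAlgebra.and_or_distrib, o3]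
    _ = cand g U := by rw [hU]

theorem ch_ada {M : Type v} [Ada M] (a : M) :
    cand (cand (cnot (Ada.down a)) (cnot (Ada.down (cnot a)))) a =
    cand (cand (cnot (Ada.down a)) (cnot (Ada.down (cnot a)))) U := by
  have hb : ∀ x : M, cand (cnot (Ada.down x)) (Ada.down x) = F := by
    intro x
    have h := congrArg cnot (Ada.down_or_not x)
    rwa [ch_not_or, CAlgebra.not_not, ch_not_T] at h
  have hbF : ∀ x : M, cand (cnot (Ada.down x)) F = F := by
    intro x
    have h := ch_and_not (cnot (Ada.down x))
    rw [CAlgebra.not_not, hb] at h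
    exact h.symm
  have hd : ∀ x : M, cand x (Ada.down x) = x := by
    intro x
    have h := Ada.down_and x T
    rw [Ada.down_T, and_T] at h
    exact h.symm
  have main : ∀ g x : M, cand g (Ada.down x) = F → cand g x = cand g (cand x F) := by
    intro g x hg
    calc cand g x = cand (cand g x) (Ada.down x) := by rw [CAlgebra.and_assoc, hd]
      _ = cand (cand (cand g x) g) (Ada.down x) := by rw [ch_xyx]
      _ = cand g (cand x F) := by rw [CAlgebra.and_assoc, hg, CAlgebra.and_assoc]
  apply ch_rel_U
  · apply main
    rw [← ch_xyx (cnot (Ada.down a)), CAlgebra.and_assoc, hb, CAlgebra.and_assoc, hbF, hbF]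
  · apply main
    rw [CAlgebra.and_assoc, hb, hbF]

theorem ch_ext {S : Type u} {M : Type v} [CAlgebraTFU M] [CSet S M] {b : M} {s t w : S}
    (h : CSet.act b s w = CSet.act b t w) (x : S) : CSet.act b s x = CSet.act b t x := by
  rw [← CSet.pos_red b s w x, h, CSet.pos_red]

/-- Two pairs that agree on `b` and `c` respectively both agree on `b ∧ c`. -/
theorem ch_left {S : Type u} {M : Type v} [CAlgebraTFU M] [CSet S M] {b : M} (c : M) {s t : S}
    (h : CSet.act b s t = CSet.act b t t) (x : S) :
    CSet.act (cand b c) s x = CSet.act (cand b c) t x :=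
  ch_ext (CSet.and_compat b c s t h) x

theorem ch_right {S : Type u} {M : Type v} [CAlgebraTFU M] [CSet S M] (b : M) {c : M} {s t : S}
    (h : CSet.act c s t = CSet.act c t t) (x : S) :
    CSet.act (cand b c) s x = CSet.act (cand b c) t x := by
  rw [CSet.and_ax, CSet.and_ax, ch_ext h x]

end CHelpers

/-- For a C-set over an ada and a maximal congruence θ on M,
the pair (E_θ, θ) is a C-set congruence: E_θ is an equivalence relation on S⊥ and the
pair is compatible with the if-then-else action. -/
theorem Erel_cset_congruence (S : Type u) (M : Type v) [Ada M] [CSet S M]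
    (θ : AdaCongruence M) (hθ : θ.IsMaximal) :
    Equivalence (Erel S M θ.rel) ∧
    ∀ (s t u v : S) (α β : M), Erel S M θ.rel s t → Erel S M θ.rel u v → θ.rel α β →
      Erel S M θ.rel (CSet.act α s u) (CSet.act β t v) := by
  have hand : ∀ {b c : M}, θ.rel b CAlgebraTFU.T → θ.rel c CAlgebraTFU.T →
      θ.rel (CAlgebra.cand b c) CAlgebraTFU.T := by
    intro b c hb hc
    have h := θ.and_compat hb hc
    rwa [CAlgebraTFU.and_T] at h
  have hE : Equivalence (Erel S M θ.rel) := by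
    refine ⟨fun s => ⟨CAlgebraTFU.T, θ.refl _, rfl⟩, ?_, ?_⟩
    · rintro s t ⟨b, hb, h⟩
      exact ⟨b, hb, (ch_ext h s).symm⟩
    · rintro s t w ⟨b, hb, h⟩ ⟨c, hc, k⟩
      exact ⟨CAlgebra.cand b c, hand hb hc, (ch_left c h w).trans (ch_right b k w)⟩
  refine ⟨hE, ?_⟩
  have hT : ∀ (a : M) (t v : S), θ.rel a CAlgebraTFU.T →
      Erel S M θ.rel (CSet.act a t v) t :=
    fun a t v ha => ⟨a, ha, CSet.pos_red a t v t⟩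
  have hF : ∀ (a : M) (t v : S), θ.rel a CAlgebraTFU.F →
      Erel S M θ.rel (CSet.act a t v) v := by
    intro a t v ha
    have h := hT (CAlgebra.cnot a) v t (by
      have := θ.not_compat ha
      rwa [ch_not_F] at this)
    rwa [CSet.not_ax] at h
  have hU : ∀ (a : M) (t v : S), θ.rel a CAlgebraTFU.U →
      Erel S M θ.rel (CSet.act a t v) (CSet.bot M) := by
    intro a t v ha
    have hn : ∀ x : M, θ.rel x CAlgebraTFU.U →
        θ.rel (CAlgebra.cnot (Ada.down x)) CAlgebraTFU.T := by
      intro x hx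
      have h := θ.not_compat (θ.down_compat hx)
      rwa [Ada.down_U, ch_not_F] at h
    have ha' : θ.rel (CAlgebra.cnot a) CAlgebraTFU.U := by
      have h := θ.not_compat ha
      rwa [CAlgebraTFU.not_U] at h
    refine ⟨_, hand (hn a ha) (hn _ ha'), ch_ext (w := v) ?_ _⟩
    rw [← CSet.and_ax, ch_ada, CSet.and_ax, CSet.U_ax]
  intro s t u v α β ⟨b, hb, h⟩ ⟨c, hc, k⟩ hαβ
  have h1 : Erel S M θ.rel (CSet.act α s u) (CSet.act α t v) := by
    refine ⟨CAlgebra.cand b c, hand hb hc, ?_⟩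
    rw [CSet.interchange, CSet.interchange (CAlgebra.cand b c) α t v t v, ch_left c h, ch_right b k]
  refine hE.trans h1 ?_
  rcases hθ.2.2.2 α with ha | ha | ha
  · exact hE.trans (hT α t v ha) (hE.symm (hT β t v (θ.trans (θ.symm hαβ) ha)))
  · exact hE.trans (hF α t v ha) (hE.symm (hF β t v (θ.trans (θ.symm hαβ) ha)))
  · exact hE.trans (hU α t v ha) (hE.symm (hU β t v (θ.trans (θ.symm hαβ) ha)))
end

section
/- Let (S⊥, M) be a C-set where M is an ada. The intersection of the relations E_θ = {(s,t) ∈ S⊥ × S⊥ : β[s,t] = β[t,t] for some β ∈ M with (β, T) ∈ θ}, as θ ranges over all maximal congruences on M, equals the diagonal Δ_{S⊥}; that is, if (s,t) ∈ E_θ for every maximal congruence θ on M, then s = t. -/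
universe u v

namespace AdaProof

open CAlgebra CAlgebraTFU Ada

section calg
variable {M : Type v} [CAlgebraTFU M]

local notation:70 a:70 "⋏" b:71 => CAlgebra.cand a b
local notation:65 a:65 "⋎" b:66 => CAlgebra.cor a b
local notation:max "∼" a:max => CAlgebra.cnot a

theorem not_or (a b : M) : ∼(a ⋎ b) = ∼a ⋏ ∼b := by
  have := CAlgebra.not_and (∼a) (∼b)
  rw [CAlgebra.not_not, CAlgebra.not_not] at this
  rw [← this, CAlgebra.not_not]

theorem not_inj {a b : M} (h : ∼a = ∼b) : a = b := by
  rw [← CAlgebra.not_not a, h, CAlgebra.not_not]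

theorem not_T : ∼(T : M) = F := by
  have h := CAlgebra.not_and (T : M) (∼F)
  rw [T_and, CAlgebra.not_not, or_F] at h
  exact h.symm

theorem not_F : ∼(F : M) = T := by
  rw [← not_T, CAlgebra.not_not]

theorem T_or (a : M) : T ⋎ a = T := by
  apply not_inj; rw [not_or, not_T, F_and]

theorem or_assoc' (a b c : M) : (a ⋎ b) ⋎ c = a ⋎ (b ⋎ c) := by
  apply not_inj; simp only [not_or, CAlgebra.and_assoc]

theorem and_absorb (a b : M) : a ⋏ (a ⋎ b) = a := by
  apply not_inj; rw [CAlgebra.not_and, not_or, absorb]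

theorem or_self' (a : M) : a ⋎ a = a := by
  have := absorb a T
  rwa [and_T] at this

theorem and_self' (a : M) : a ⋏ a = a := by
  apply not_inj; rw [CAlgebra.not_and, or_self']

theorem and_and_self (a b : M) : a ⋏ (a ⋏ b) = a ⋏ b := by
  rw [← CAlgebra.and_assoc, and_self']

theorem or_red (a b : M) : a ⋎ b = a ⋎ (∼a ⋏ b) := by
  have := CAlgebra.or_and a b T
  simpa only [and_T] using this

theorem and_red (a b : M) : a ⋏ b = a ⋏ (∼a ⋎ b) := by
  apply not_inj; rw [CAlgebra.not_and, CAlgebra.not_and, not_or]; exact or_red _ _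

theorem and_not (a : M) : a ⋏ ∼a = a ⋏ F := by
  rw [and_red a F, or_F]

/-- Boolean (two-valued) elements. -/
def Bo (a : M) : Prop := a ⋏ F = F

theorem Bo.of_or {a : M} (h : a ⋎ ∼a = T) : Bo a := by
  have h1 : ∼a ⋏ a = F := by
    have := congrArg cnot h
    rwa [not_or, CAlgebra.not_not, not_T] at this
  have h2 : ∼a ⋏ F = F := by
    rw [← and_not, CAlgebra.not_not, h1]
  have h3 := CAlgebra.or_and a (∼a) F
  rw [h, T_and, and_and_self, h2, or_F] at h3
  exact h3.symm

theorem Bo.and_not {a : M} (h : Bo a) : a ⋏ ∼a = F := by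
  rw [AdaProof.and_not]; exact h

theorem Bo.not_or {a : M} (h : Bo a) : ∼a ⋎ a = T := by
  have := congrArg cnot h.and_not
  rwa [CAlgebra.not_and, CAlgebra.not_not, not_F] at this

theorem Bo.not {a : M} (h : Bo a) : Bo (∼a) := by
  apply Bo.of_or; rw [CAlgebra.not_not]; exact h.not_or

theorem Bo.or_not {a : M} (h : Bo a) : a ⋎ ∼a = T := by
  have := h.not.not_or
  rwa [CAlgebra.not_not] at this

theorem Bo.not_and {a : M} (h : Bo a) : ∼a ⋏ a = F := by
  have := h.not.and_not
  rwa [CAlgebra.not_not] at this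

theorem Bo.and {a b : M} (ha : Bo a) (hb : Bo b) : Bo (a ⋏ b) := by
  unfold Bo at *; rw [CAlgebra.and_assoc, hb, ha]

theorem Bo.or {a b : M} (ha : Bo a) (hb : Bo b) : Bo (a ⋎ b) := by
  have := (ha.not.and hb.not).not
  rwa [CAlgebra.not_and, CAlgebra.not_not, CAlgebra.not_not] at this

theorem Bo_F : Bo (F : M) := F_and _
theorem Bo_T : Bo (T : M) := T_and _

theorem Bo.split {a : M} (h : Bo a) (c : M) : c = (a ⋏ c) ⋎ (∼a ⋏ c) := by
  have := CAlgebra.or_and a (∼a) c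
  rwa [h.or_not, T_and, and_and_self] at this

theorem Bo.aux {a b : M} (ha : Bo a) (hb : Bo b) :
    a ⋏ (b ⋏ ∼a) = ∼b ⋏ (a ⋏ (b ⋏ ∼a)) := by
  have h := congrArg (fun x => x ⋏ ∼a) (quasi_comm a b)
  simp only [CAlgebra.or_and, CAlgebra.and_assoc, ha.and_not] at h
  have hbF : b ⋏ F = F := hb
  rw [hbF] at h
  have h1 : ∼(a ⋏ b) ⋏ F = F := (ha.and hb).not
  rw [h1, or_F, F_or] at h
  rw [h]
  rw [CAlgebra.not_and, CAlgebra.or_and]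
  have : ∼a ⋏ (a ⋏ (b ⋏ ∼a)) = F := by rw [← CAlgebra.and_assoc, ha.not_and, F_and]
  rw [this, CAlgebra.not_not, hbF, or_F, and_and_self]

theorem Bo.aba {a b : M} (ha : Bo a) (hb : Bo b) : a ⋏ (b ⋏ ∼a) = F := by
  have h1 := ha.aux hb
  have h2 := hb.not.aux ha
  rw [CAlgebra.not_not] at h2
  -- h2 : ∼b ⋏ (a ⋏ b) = ∼a ⋏ (∼b ⋏ (a ⋏ b))
  have h3 : a ⋏ (∼b ⋏ (a ⋏ b)) = F := by
    rw [h2, ← CAlgebra.and_assoc, ha.and_not, F_and]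
  calc a ⋏ (b ⋏ ∼a) = a ⋏ (a ⋏ (b ⋏ ∼a)) := (and_and_self _ _).symm
    _ = a ⋏ (∼b ⋏ (a ⋏ (b ⋏ ∼a))) := by rw [← h1]
    _ = (a ⋏ (∼b ⋏ (a ⋏ b))) ⋏ ∼a := by simp only [CAlgebra.and_assoc]
    _ = F := by rw [h3, F_and]

theorem Bo.comm {a b : M} (ha : Bo a) (hb : Bo b) : a ⋏ b = b ⋏ a := by
  have h1 : a ⋏ b = a ⋏ (b ⋏ a) := by
    have : a ⋏ b = a ⋏ (b ⋏ (a ⋎ ∼a)) := by rw [ha.or_not, and_T]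
    rw [and_or_distrib, and_or_distrib, ha.aba hb, or_F] at this
    exact this
  have h2 := ha.split (b ⋏ a)
  have h3 := ha.not.aba hb
  rw [CAlgebra.not_not] at h3
  rw [h3, or_F] at h2
  rw [h1, ← h2]

theorem Bo.or_comm {a b : M} (ha : Bo a) (hb : Bo b) : a ⋎ b = b ⋎ a := by
  apply not_inj; rw [AdaProof.not_or, AdaProof.not_or, ha.not.comm hb.not]

/-- The Boolean elements form a lattice. -/
def BoSub (M : Type v) [CAlgebraTFU M] := {a : M // Bo a}

/-- Constructor for `BoSub`. -/
def BoSub.mk (a : M) (h : Bo a) : BoSub M := ⟨a, h⟩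

instance : Max (BoSub M) := ⟨fun a b => ⟨a.1 ⋎ b.1, a.2.or b.2⟩⟩
instance : Min (BoSub M) := ⟨fun a b => ⟨a.1 ⋏ b.1, a.2.and b.2⟩⟩

instance : Lattice (BoSub M) := Lattice.mk'
  (fun a b => Subtype.ext (a.2.or_comm b.2))
  (fun a b c => Subtype.ext (or_assoc' a.1 b.1 c.1))
  (fun a b => Subtype.ext (a.2.comm b.2))
  (fun a b c => Subtype.ext (CAlgebra.and_assoc a.1 b.1 c.1))
  (fun a b => Subtype.ext (absorb a.1 b.1))
  (fun a b => Subtype.ext (and_absorb a.1 b.1))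

instance : DistribLattice (BoSub M) := DistribLattice.ofInfSupLe
  (fun a b c => le_of_eq (Subtype.ext (and_or_distrib a.1 b.1 c.1)))

/-- Properties of (the indicator of) an ultrafilter of Boolean elements. -/
structure IsUF (Q : M → Prop) : Prop where
  and : ∀ a b, Bo a → Bo b → (Q (a ⋏ b) ↔ Q a ∧ Q b)
  or : ∀ a b, Bo a → Bo b → (Q (a ⋎ b) ↔ Q a ∨ Q b)
  T : Q T
  F : ¬ Q F

theorem exists_UF (I : M → Prop) (hF : I F) (hT : ¬ I T)
    (hor : ∀ a b, Bo a → Bo b → I a → I b → I (a ⋎ b))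
    (hand : ∀ a b, Bo a → Bo b → I a → I (a ⋏ b)) :
    ∃ Q : M → Prop, IsUF Q ∧ ∀ a, Bo a → I a → ¬ Q a := by
  let J : Order.Ideal (BoSub M) :=
    { carrier := {a | I a.1}
      lower' := by
        intro a b hba ha
        have : b = a ⊓ b := (inf_eq_right.2 hba).symm
        have h2 := hand a.1 b.1 a.2 b.2 ha
        have h3 : b.1 = a.1 ⋏ b.1 := congrArg Subtype.val this
        show I b.1
        rw [h3]; exact h2
      nonempty' := ⟨⟨F, Bo_F⟩, hF⟩
      directed' := by
        intro a ha b hb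
        exact ⟨a ⊔ b, hor a.1 b.1 a.2 b.2 ha hb, le_sup_left, le_sup_right⟩ }
  let t : BoSub M := ⟨T, Bo_T⟩
  have ht : ∀ a : BoSub M, a ≤ t := fun a =>
    inf_eq_left.1 (Subtype.ext (and_T a.1))
  let G : Order.PFilter (BoSub M) := Order.PFilter.principal t
  have hd : Disjoint (G : Set (BoSub M)) (J : Set (BoSub M)) := by
    rw [Set.disjoint_left]
    intro a ha hJ
    have h1 : t ≤ a := ha
    have h2 : a = t := le_antisymm (ht a) h1
    subst h2
    exact hT hJ
  obtain ⟨K, hK, hJK, hGK⟩ := DistribLattice.prime_ideal_of_disjoint_filter_ideal hd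
  have htK : t ∉ K := fun h => Set.disjoint_left.1 hGK (le_refl t : t ≤ t) h
  refine ⟨fun a => ∃ h : Bo a, (⟨a, h⟩ : BoSub M) ∉ K, ⟨?_, ?_, ⟨Bo_T, htK⟩, ?_⟩, ?_⟩
  · intro a b ha hb
    constructor
    · rintro ⟨h, hn⟩
      exact ⟨⟨ha, fun hk => hn (K.lower (inf_le_left (a := BoSub.mk a ha) (b := BoSub.mk b hb)) hk)⟩,
        ⟨hb, fun hk => hn (K.lower (inf_le_right (a := BoSub.mk a ha) (b := BoSub.mk b hb)) hk)⟩⟩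
    · rintro ⟨⟨_, h1⟩, ⟨_, h2⟩⟩
      refine ⟨ha.and hb, fun hk => ?_⟩
      rcases hK.mem_or_mem (x := BoSub.mk a ha) (y := BoSub.mk b hb) hk with h | h
      · exact h1 h
      · exact h2 h
  · intro a b ha hb
    constructor
    · rintro ⟨h, hn⟩
      by_contra hc
      push Not at hc
      exact hn (Order.Ideal.sup_mem (x := BoSub.mk a ha) (y := BoSub.mk b hb) (hc.1 ha) (hc.2 hb))
    · rintro (⟨_, h⟩ | ⟨_, h⟩)
      · exact ⟨ha.or hb, fun hk => h (K.lower (le_sup_left (a := BoSub.mk a ha) (b := BoSub.mk b hb)) hk)⟩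
      · exact ⟨ha.or hb, fun hk => h (K.lower (le_sup_right (a := BoSub.mk a ha) (b := BoSub.mk b hb)) hk)⟩
  · rintro ⟨h, hn⟩
    exact hn (hJK (show (⟨F, h⟩ : BoSub M) ∈ J from hF))
  · rintro a ha hI ⟨h, hn⟩
    exact hn (hJK (show (⟨a, h⟩ : BoSub M) ∈ J from hI))

theorem IsUF.not {Q : M → Prop} (hQ : IsUF Q) {a : M} (ha : Bo a) : Q (∼a) ↔ ¬ Q a := by
  have h1 := hQ.and a (∼a) ha ha.not
  have h2 := hQ.or a (∼a) ha ha.not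
  rw [ha.and_not] at h1
  rw [ha.or_not] at h2
  have := hQ.T
  have := hQ.F
  tauto

end calg

section ada
variable {M : Type v} [Ada M]

local notation:70 a:70 "⋏" b:71 => CAlgebra.cand a b
local notation:65 a:65 "⋎" b:66 => CAlgebra.cor a b
local notation:max "∼" a:max => CAlgebra.cnot a
local notation:max a:max "↡" => Ada.down a

theorem bo_down (a : M) : Bo (a↡) := Bo.of_or (down_or_not a)

theorem and_down_self (a : M) : a ⋏ a↡ = a := by
  have := down_and a T
  rw [down_T, and_T] at this
  exact this.symm

theorem down_and_self (a : M) : a↡ ⋏ a = a↡ := by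
  have := and_absorb (a↡) a
  rwa [← down_or a] at this

theorem Bo.down {a : M} (h : Bo a) : a↡ = a := by
  rw [← down_and_self a, (bo_down a).comm h, and_down_self]

theorem and_down_not (a : M) : a ⋏ (∼a)↡ = a ⋏ F := by
  rw [down_and, and_not, ← down_and, down_F]

theorem down_disj (a : M) : a↡ ⋏ (∼a)↡ = F := by
  rw [← down_and_self a, CAlgebra.and_assoc, and_down_not, ← CAlgebra.and_assoc, down_and_self]
  exact bo_down a

theorem down_mul (a b : M) : (a ⋏ b)↡ = a↡ ⋏ b↡ := by
  generalize he : (a ⋏ b)↡ = e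
  have hbe : Bo e := he ▸ bo_down _
  have h1 : e ⋏ (a ⋏ b) = e := by rw [← he, down_and_self]
  have hx : e ⋏ a = e := by
    have q := congrArg (fun z => (e ⋏ a) ⋏ z) (quasi_comm (e ⋏ a) b)
    have hxb : (e ⋏ a) ⋏ b = e := by rw [CAlgebra.and_assoc, h1]
    simp only [and_or_distrib] at q
    have h2 : (e ⋏ a) ⋏ ((e ⋏ a) ⋏ b) = e := by rw [and_and_self, hxb]
    have h3 : (e ⋏ a) ⋏ (b ⋏ (e ⋏ a)) = e ⋏ a := by
      rw [← CAlgebra.and_assoc, hxb, and_and_self]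
    rw [h2, h3, absorb] at q
    have h4 := absorb (e ⋏ a) b
    rw [hxb] at h4
    rw [← h4, ← q]
  have h5 : e ⋏ a↡ = e := by
    rw [down_and, hx, hbe.down, and_self']
  have h6 : a↡ ⋏ b↡ = a↡ ⋏ e := by
    rw [← down_and_self a, CAlgebra.and_assoc, down_and a b, he, ← CAlgebra.and_assoc, down_and_self]
  rw [h6, (bo_down a).comm hbe, h5]

theorem bo_and_down {m : M} (hm : Bo m) (a : M) : (m ⋏ a)↡ = m ⋏ a↡ := by
  rw [down_mul, hm.down]

theorem undef {m a : M} (hm : Bo m) (h1 : m ⋏ a↡ = F) (h2 : m ⋏ (∼a)↡ = F) :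
    m ⋏ a = m ⋏ U := by
  have key : ∀ c : M, m ⋏ c↡ = F → ∀ b, m ⋏ (c ⋏ b) = m ⋏ c := by
    intro c hc b
    have hx := and_down_self (m ⋏ c)
    rw [bo_and_down hm, hc] at hx
    calc m ⋏ (c ⋏ b) = (m ⋏ c) ⋏ b := (CAlgebra.and_assoc _ _ _).symm
      _ = m ⋏ c := by rw [← hx, CAlgebra.and_assoc, F_and, hx]
  have ka := key a h1
  have kna := key (∼a) h2
  have h3 : m ⋏ (a ⋎ U) = m ⋏ a := by
    calc m ⋏ (a ⋎ U) = m ⋏ (∼m ⋎ (a ⋎ U)) := and_red _ _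
      _ = m ⋏ ∼(m ⋏ (∼a ⋏ U)) := by
        rw [CAlgebra.not_and, CAlgebra.not_and, CAlgebra.not_not, CAlgebraTFU.not_U]
      _ = m ⋏ ∼(m ⋏ ∼a) := by rw [kna]
      _ = m ⋏ (∼m ⋎ a) := by rw [CAlgebra.not_and, CAlgebra.not_not]
      _ = m ⋏ a := (and_red _ _).symm
  have q := congrArg (fun z => m ⋏ z) (quasi_comm a U)
  simp only [U_and, U_or] at q
  rw [and_or_distrib, ka, ← and_or_distrib, h3] at q
  exact q

theorem down_or' (a b : M) : (a ⋎ b)↡ = a↡ ⋎ ((∼a)↡ ⋏ b↡) := by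
  have hg := bo_down (a ⋎ b)
  have ha := bo_down a
  have hd := bo_down (∼a)
  have h1 : a↡ ⋏ (a ⋎ b)↡ = a↡ := by
    have : a↡ ⋏ (a ⋎ b) = a↡ := by
      rw [← down_and_self a, CAlgebra.and_assoc, and_absorb]
    rw [down_and, this, ha.down, and_self']
  have h2 : (∼a)↡ ⋏ (a ⋎ b)↡ = (∼a)↡ ⋏ b↡ := by
    have h : (∼a)↡ ⋏ a = F := by
      rw [← down_and_self (∼a), CAlgebra.and_assoc]
      have := and_not (∼a)
      rw [CAlgebra.not_not] at this
      rw [this, ← CAlgebra.and_assoc, down_and_self]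
      exact hd
    rw [down_and, and_or_distrib, h, F_or, ← down_and]
  have h3 : ∼((∼a)↡) ⋏ (∼(a↡) ⋏ (a ⋎ b)↡) = F := by
    have hm : Bo (∼((∼a)↡) ⋏ (∼(a↡) ⋏ (a ⋎ b)↡)) := hd.not.and (ha.not.and hg)
    have e1 : (∼((∼a)↡) ⋏ (∼(a↡) ⋏ (a ⋎ b)↡)) ⋏ a↡ = F := by
      rw [hm.comm ha, hd.not.comm (ha.not.and hg), CAlgebra.and_assoc, ← CAlgebra.and_assoc, ha.and_not, F_and]
    have e2 : (∼((∼a)↡) ⋏ (∼(a↡) ⋏ (a ⋎ b)↡)) ⋏ (∼a)↡ = F := by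
      rw [hm.comm hd, ← CAlgebra.and_assoc, hd.and_not, F_and]
    have e3 : (∼((∼a)↡) ⋏ (∼(a↡) ⋏ (a ⋎ b)↡)) ⋏ (a ⋎ b)
        = ∼((∼a)↡) ⋏ (∼(a↡) ⋏ (a ⋎ b)↡) := by
      rw [CAlgebra.and_assoc, CAlgebra.and_assoc, down_and_self]
    generalize ∼((∼a)↡) ⋏ (∼(a↡) ⋏ (a ⋎ b)↡) = m at *
    have e4 := undef hm e1 e2
    have e5 : m ⋏ (a ⋎ b) = m ⋏ U := by
      rw [and_or_distrib, e4, ← and_or_distrib, U_or]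

    rw [e3] at e5
    have := bo_and_down hm U
    rw [← e5, hm.down, down_U] at this
    rw [this]; exact hm
  have s1 := ha.split ((a ⋎ b)↡)
  have s2 := hd.split (∼(a↡) ⋏ (a ⋎ b)↡)
  have h4 : (∼a)↡ ⋏ (∼(a↡) ⋏ (a ⋎ b)↡) = ∼(a↡) ⋏ ((∼a)↡ ⋏ b↡) := by
    rw [← h2, ← CAlgebra.and_assoc, hd.comm ha.not, CAlgebra.and_assoc]
  rw [h3, or_F, h4] at s2
  rw [s2, h1, ← or_red] at s1
  exact s1

/-- The congruence determined by an ultrafilter. -/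
def cong (Q : M → Prop) (hQ : IsUF Q) : AdaCongruence M where
  rel a b := (Q (a↡) ↔ Q (b↡)) ∧ (Q ((∼a)↡) ↔ Q ((∼b)↡))
  refl _ := ⟨Iff.rfl, Iff.rfl⟩
  symm h := ⟨h.1.symm, h.2.symm⟩
  trans h k := ⟨h.1.trans k.1, h.2.trans k.2⟩
  or_compat := by
    rintro a b c d ⟨h1, h2⟩ ⟨h3, h4⟩
    simp only [down_or', not_or, down_mul,
      hQ.or _ _ (bo_down _) ((bo_down _).and (bo_down _)), hQ.and _ _ (bo_down _) (bo_down _)]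
    tauto
  and_compat := by
    rintro a b c d ⟨h1, h2⟩ ⟨h3, h4⟩
    simp only [down_or', CAlgebra.not_and, down_mul, CAlgebra.not_not,
      hQ.or _ _ (bo_down _) ((bo_down _).and (bo_down _)), hQ.and _ _ (bo_down _) (bo_down _)]
    tauto
  not_compat := by
    rintro a b ⟨h1, h2⟩
    rw [CAlgebra.not_not, CAlgebra.not_not]
    exact ⟨h2, h1⟩
  down_compat := by
    rintro a b ⟨h1, h2⟩
    rw [(bo_down a).down, (bo_down b).down, (bo_down a).not.down, (bo_down b).not.down,
      hQ.not (bo_down _), hQ.not (bo_down _)]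
    tauto

theorem cong_max (Q : M → Prop) (hQ : IsUF Q) : (cong Q hQ).IsMaximal := by
  have hT := hQ.T
  have hF := hQ.F
  refine ⟨?_, ?_, ?_, ?_⟩
  · rintro ⟨h1, h2⟩
    rw [down_T, down_F] at h1
    tauto
  · rintro ⟨h1, h2⟩
    rw [down_T, down_U] at h1
    tauto
  · rintro ⟨h1, h2⟩
    rw [not_F, CAlgebraTFU.not_U, down_T, down_U] at h2
    tauto
  · intro a
    have h := hQ.and _ _ (bo_down a) (bo_down (∼a))
    rw [down_disj] at h
    simp only [cong, not_T, not_F, CAlgebraTFU.not_U, down_T, down_U, down_F]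
    tauto

end ada

end AdaProof

/-- For a C-set over an ada, the intersection of the relations E_θ, as θ
ranges over all maximal congruences on M, is the diagonal of S⊥. -/
theorem Erel_inter_eq_diagonal (S : Type u) (M : Type v) [Ada M] [CSet S M]
    (s t : S) (h : ∀ θ : AdaCongruence M, θ.IsMaximal → Erel S M θ.rel s t) :
    s = t := by
  have actT : ∀ x y : S, CSet.act (CAlgebraTFU.T : M) x y = x := by
    intro x y
    rw [← AdaProof.not_F, CSet.not_ax, CSet.F_ax]
  have actor : ∀ (a b : M) (x y : S),
      CSet.act (CAlgebra.cor a b) x y = CSet.act a x (CSet.act b x y) := by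
    intro a b x y
    rw [← CAlgebra.not_not (CAlgebra.cor a b), AdaProof.not_or, CSet.not_ax, CSet.and_ax,
      CSet.not_ax, CSet.not_ax]
  by_contra hne
  obtain ⟨Q, hQ, hI⟩ := AdaProof.exists_UF (M := M)
    (fun a => CSet.act a s t = CSet.act a t t)
    (by rw [CSet.F_ax, CSet.F_ax]) (by rw [actT, actT]; exact hne)
    (by
      intro a b ha hb h1 h2
      have hbt : CSet.act b t t = t := by
        have := actT t t
        rw [← hb.or_not, actor, CSet.not_ax, CSet.neg_red] at this
        exact this
      show CSet.act _ s t = CSet.act _ t t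
      rw [actor, actor, h2, hbt, h1])
    (by
      intro a b _ _ h1
      exact CSet.and_compat a b s t h1)
  obtain ⟨β, ⟨h1, _⟩, h2⟩ := h (AdaProof.cong Q hQ) (AdaProof.cong_max Q hQ)
  rw [Ada.down_T] at h1
  have h3 := h1.2 hQ.T
  refine hI _ (AdaProof.bo_down β) ?_ h3
  have hd : CSet.act (Ada.down β) s t = CSet.act (Ada.down β) t t := by
    rw [← AdaProof.down_and_self β, CSet.and_ax, CSet.and_ax, h2]
  exact hd
end

section
/- Every C-set (S⊥, M) where M is an ada is a subdirect product of basic C-sets: the canonical two-sorted map into the product over all maximal congruences θ on M of the quotients (S⊥/E_θ, M/θ) is an embedding whose coordinate projections are surjective, and each quotient (S⊥/E_θ, M/θ) is a basic C-set (with M/θ ≅ 3). -/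
universe u v

section Helpers

open CAlgebra CAlgebraTFU Ada

namespace CHelp

section alg
variable {M : Type v} [CAlgebraTFU M]

local infixl:70 "⋏" => CAlgebra.cand
local infixl:65 "⋎" => CAlgebra.cor
local prefix:80 "∼" => CAlgebra.cnot

theorem not_or (a b : M) : ∼(a ⋎ b) = ∼a ⋏ ∼b := by
  rw [← CAlgebra.not_not (∼a ⋏ ∼b), CAlgebra.not_and, CAlgebra.not_not, CAlgebra.not_not]

theorem not_T : ∼(T : M) = F := by
  have h : ∼((T : M) ⋏ ∼F) = ∼(T : M) ⋎ ∼∼F := CAlgebra.not_and _ _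
  rw [T_and, CAlgebra.not_not, or_F] at h
  exact h.symm

theorem not_F : ∼(F : M) = T := by rw [← not_T, CAlgebra.not_not]

theorem not_inj {a b : M} (h : ∼a = ∼b) : a = b := by
  rw [← CAlgebra.not_not a, h, CAlgebra.not_not]

theorem or_assoc (a b c : M) : (a ⋎ b) ⋎ c = a ⋎ (b ⋎ c) := by
  apply not_inj; simp only [not_or, CAlgebra.and_assoc]

theorem or_idem (a : M) : a ⋎ a = a := by
  have := CAlgebra.absorb a (T : M)
  rwa [and_T] at this

theorem and_idem (a : M) : a ⋏ a = a := by
  apply not_inj; rw [CAlgebra.not_and, or_idem]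

theorem absorb' (a b : M) : a ⋏ (a ⋎ b) = a := by
  apply not_inj; rw [CAlgebra.not_and, not_or, CAlgebra.absorb]

theorem T_or (a : M) : T ⋎ a = T := by
  apply not_inj; rw [not_or, not_T, F_and]

theorem or_and_distrib (a b c : M) : a ⋎ (b ⋏ c) = (a ⋎ b) ⋏ (a ⋎ c) := by
  apply not_inj
  rw [not_or, CAlgebra.not_and, CAlgebra.not_and, not_or, not_or, CAlgebra.and_or_distrib]

theorem and_or (a b c : M) : (a ⋏ b) ⋎ c = (a ⋎ c) ⋏ (∼a ⋎ (b ⋎ c)) := by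
  apply not_inj
  rw [not_or, CAlgebra.not_and, CAlgebra.or_and, CAlgebra.not_and, not_or, not_or, not_or]

theorem quasi' (a b : M) : (a ⋎ b) ⋏ (b ⋎ a) = (b ⋎ a) ⋏ (a ⋎ b) := by
  apply not_inj
  simp only [not_or, CAlgebra.not_and]
  exact CAlgebra.quasi_comm _ _

theorem or_red (a b : M) : a ⋎ (∼a ⋏ b) = a ⋎ b := by
  have h := CAlgebra.or_and a b (T : M)
  simp only [and_T] at h
  exact h.symm

theorem and_red (a b : M) : a ⋏ (∼a ⋎ b) = a ⋏ b := by
  apply not_inj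
  rw [CAlgebra.not_and, CAlgebra.not_and, not_or, or_red]

/-- Boolean elements. -/
def IsB (a : M) : Prop := a ⋎ ∼a = T

theorem IsB.not_and_self {a : M} (h : IsB a) : ∼a ⋏ a = F := by
  rw [← not_T, ← h, not_or, CAlgebra.not_not]

theorem IsB.and_F {a : M} (h : IsB a) : a ⋏ F = F := by
  have h1 : ∼a ⋏ F = F := by
    rw [← and_red, or_F, CAlgebra.not_not, h.not_and_self]
  have h2 := CAlgebra.or_and a (∼a) (F : M)
  rw [show a ⋎ ∼a = T from h, T_and, ← CAlgebra.and_assoc (∼a), and_idem, h1, or_F] at h2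
  exact h2.symm

theorem IsB.and_not_self {a : M} (h : IsB a) : a ⋏ ∼a = F := by
  rw [← or_F (∼a), and_red, h.and_F]

theorem IsB.not {a : M} (h : IsB a) : IsB (∼a) := by
  have := congrArg CAlgebra.cnot h.and_not_self
  rwa [CAlgebra.not_and, not_F] at this

theorem IsB.or_T {a : M} (h : IsB a) : a ⋎ T = T := by
  apply not_inj; rw [not_or, not_T, h.not.and_F]

theorem or_and_swap (a b : M) : (a ⋎ b) ⋏ (b ⋎ a) = (a ⋏ (b ⋎ T)) ⋎ (∼a ⋏ b) := by
  rw [CAlgebra.or_and, absorb', CAlgebra.and_or_distrib, CAlgebra.and_or_distrib, and_T, and_idem]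

theorem IsB.or_comm {a b : M} (ha : IsB a) (hb : IsB b) : a ⋎ b = b ⋎ a := by
  have h := quasi' a b
  rw [or_and_swap, or_and_swap, ha.or_T, hb.or_T, and_T, and_T, or_red, or_red] at h
  exact h

theorem IsB.and_comm {a b : M} (ha : IsB a) (hb : IsB b) : a ⋏ b = b ⋏ a := by
  apply not_inj; rw [CAlgebra.not_and, CAlgebra.not_and, ha.not.or_comm hb.not]

theorem IsB.and {a b : M} (ha : IsB a) (hb : IsB b) : IsB (a ⋏ b) := by
  unfold IsB
  rw [CAlgebra.not_and, and_or, ← or_assoc a, show a ⋎ ∼a = T from ha, T_or, T_and,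
    ← or_assoc b, hb.or_comm ha.not, or_assoc (∼a) b, show b ⋎ ∼b = T from hb, ha.not.or_T,
    ha.not.or_T]

theorem IsB.or {a b : M} (ha : IsB a) (hb : IsB b) : IsB (a ⋎ b) := by
  have := (ha.not.and hb.not).not
  rwa [CAlgebra.not_and, CAlgebra.not_not, CAlgebra.not_not] at this

theorem isB_T : IsB (T : M) := T_or _
theorem isB_F : IsB (F : M) := by rw [← not_T]; exact isB_T.not

theorem IsB.reg {c : M} (hc : IsB c) (b : M) : c ⋏ (b ⋏ c) = c ⋏ b := by
  have h : ∼c ⋎ (b ⋏ c) = ∼c ⋎ b := by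
    have h0 : ∼c ⋎ ∼∼c = T := hc.not
    rw [CAlgebra.not_not] at h0
    rw [or_and_distrib, h0, and_T]
  rw [← and_red, h, and_red]

theorem not_cong {c x y : M} (h : c ⋏ x = c ⋏ y) : c ⋏ ∼x = c ⋏ ∼y := by
  rw [← and_red c (∼x), ← and_red c (∼y), ← CAlgebra.not_and, ← CAlgebra.not_and, h]

theorem IsB.and_cong {c x y z w : M} (hc : IsB c) (h : c ⋏ x = c ⋏ y) (h' : c ⋏ z = c ⋏ w) :
    c ⋏ (x ⋏ z) = c ⋏ (y ⋏ w) := by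
  have key : ∀ p q : M, c ⋏ (p ⋏ q) = (c ⋏ p) ⋏ (c ⋏ q) := fun p q => by
    rw [← CAlgebra.and_assoc c p q]
    conv_lhs => rw [← hc.reg p]
    simp only [CAlgebra.and_assoc]
  rw [key, key, h, h']

theorem IsB.or_cong {c x y z w : M} (_hc : IsB c) (h : c ⋏ x = c ⋏ y) (h' : c ⋏ z = c ⋏ w) :
    c ⋏ (x ⋎ z) = c ⋏ (y ⋎ w) := by
  rw [CAlgebra.and_or_distrib, CAlgebra.and_or_distrib, h, h']

end alg

section ada
variable {M : Type v} [Ada M]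

local infixl:70 "⋏" => CAlgebra.cand
local infixl:65 "⋎" => CAlgebra.cor
local prefix:80 "∼" => CAlgebra.cnot

theorem isB_down (α : M) : IsB (down α) := down_or_not α

theorem down_and_self (α : M) : down α ⋏ α = down α := by
  have h := absorb' (down α) α
  rwa [← down_or] at h

theorem down_T_eq (α : M) : down α ⋏ α = down α ⋏ T := by
  rw [down_and_self, and_T]

theorem down_not_F_eq (α : M) : down (∼α) ⋏ α = down (∼α) ⋏ F := by
  have := not_cong (down_T_eq (∼α))
  rwa [CAlgebra.not_not, not_T] at this

theorem and_down_self (α : M) : α ⋏ down α = α := by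
  have := down_and α (T : M)
  rw [down_T, and_T] at this
  exact this.symm

/-- The Boolean part on which `α` is undefined. -/
def und (α : M) : M := ∼(down α) ⋏ ∼(down (∼α))

theorem isB_und (α : M) : IsB (und α) := (isB_down α).not.and (isB_down _).not

theorem und_not (α : M) : und (∼α) = und α := by
  unfold und
  rw [CAlgebra.not_not, (isB_down (∼α)).not.and_comm (isB_down _).not]

theorem und_and_F (α : M) : und α ⋏ α = und α ⋏ (α ⋏ F) := by
  have h : und α ⋏ down α = und α ⋏ F := by
    rw [(isB_und α).and_F, (isB_und α).and_comm (isB_down α), und, ← CAlgebra.and_assoc,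
      (isB_down α).and_not_self, F_and]
  have h2 : und α ⋏ (α ⋏ down α) = und α ⋏ (α ⋏ F) := (isB_und α).and_cong rfl h
  rwa [and_down_self] at h2

theorem und_and_U' (α : M) : und α ⋏ (α ⋏ U) = und α ⋏ α := by
  have h : und α ⋏ (α ⋏ U) = und α ⋏ ((α ⋏ F) ⋏ U) := (isB_und α).and_cong (und_and_F α) rfl
  rw [h, CAlgebra.and_assoc α, F_and, ← und_and_F]

theorem und_and_U (α : M) : und α ⋏ α = und α ⋏ U := by
  have q := CAlgebra.quasi_comm α (U : M)
  rw [U_and, U_or] at q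
  have q2 : und α ⋏ (α ⋎ U) = und α ⋏ U := by
    rw [← q, q]
    conv_rhs => rw [← q]
    exact (isB_und α).or_cong (und_and_U' α).symm rfl
  have q3 := not_cong q2
  rw [not_or, not_U] at q3
  have q4 := und_and_U' (∼α)
  rw [und_not] at q4
  rw [q4] at q3
  have q5 := not_cong q3
  rwa [CAlgebra.not_not, not_U] at q5

variable (M) in
/-- The type of Boolean elements. -/
def BoolPart : Type v := {a : M // IsB a}

instance : Max (BoolPart M) := ⟨fun a b => ⟨a.1 ⋎ b.1, a.2.or b.2⟩⟩
instance : Min (BoolPart M) := ⟨fun a b => ⟨a.1 ⋏ b.1, a.2.and b.2⟩⟩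

instance : Lattice (BoolPart M) := Lattice.mk'
  (fun a b => Subtype.ext (a.2.or_comm b.2))
  (fun a b c => Subtype.ext (or_assoc _ _ _))
  (fun a b => Subtype.ext (a.2.and_comm b.2))
  (fun a b c => Subtype.ext (CAlgebra.and_assoc _ _ _))
  (fun a b => Subtype.ext (CAlgebra.absorb _ _))
  (fun a b => Subtype.ext (absorb' _ _))

instance : DistribLattice (BoolPart M) where
  le_sup_inf a b c := le_of_eq (Subtype.ext (or_and_distrib a.1 b.1 c.1).symm)

theorem le_iff {a b : BoolPart M} : a ≤ b ↔ a.1 ⋏ b.1 = a.1 := by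
  rw [← inf_eq_left]
  exact Subtype.ext_iff

/-- A prime filter avoiding a given proper ideal of Boolean elements. -/
theorem exists_prime (I : M → Prop) (hF : I F) (hT : ¬ I T)
    (hand : ∀ a b, IsB a → IsB b → I a → I (a ⋏ b))
    (hor : ∀ a b, IsB a → IsB b → I a → I b → I (a ⋎ b)) :
    ∃ P : M → Prop, (∀ a, P a → IsB a) ∧ (∀ a, P a → ¬ I a) ∧ P T ∧ ¬ P F ∧
      (∀ a b, P a → P b → P (a ⋏ b)) ∧ (∀ a, IsB a → P a ∨ P (∼a)) := by
  let bF : BoolPart M := ⟨F, isB_F⟩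
  let bT : BoolPart M := ⟨T, isB_T⟩
  let J : Order.Ideal (BoolPart M) :=
    { carrier := {a | I a.1}
      lower' := by
        intro a b hba ha
        have h := le_iff.1 hba
        have h2 := hand a.1 b.1 a.2 b.2 ha
        rw [a.2.and_comm b.2, h] at h2
        exact h2
      nonempty' := ⟨bF, hF⟩
      directed' := fun a ha b hb => ⟨a ⊔ b, hor _ _ a.2 b.2 ha hb, le_sup_left, le_sup_right⟩ }
  have hd : Disjoint ((Order.PFilter.principal bT : Order.PFilter (BoolPart M)) :
      Set (BoolPart M)) (J : Set (BoolPart M)) := by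
    rw [Set.disjoint_left]
    intro a ha haJ
    have ha' : bT ≤ a := ha
    have h := le_iff.1 ha'
    have h2 : a.1 = T := by rw [← T_and a.1]; exact h
    apply hT
    rw [← h2]
    exact haJ
  obtain ⟨Q, hQ, hJQ, hdQ⟩ := DistribLattice.prime_ideal_of_disjoint_filter_ideal hd
  have hTQ : bT ∉ Q := fun h => Set.disjoint_left.1 hdQ (le_refl bT) h
  refine ⟨fun a => ∃ h : IsB a, (⟨a, h⟩ : BoolPart M) ∉ Q, fun a h => h.1, ?_, ⟨isB_T, hTQ⟩, ?_,
    ?_, ?_⟩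
  · rintro a ⟨h, hn⟩ hI
    exact hn (hJQ (show (⟨a, h⟩ : BoolPart M) ∈ J from hI))
  · rintro ⟨h, hn⟩
    exact hn (hJQ (show (⟨F, h⟩ : BoolPart M) ∈ J from hF))
  · rintro a b ⟨ha, hna⟩ ⟨hb, hnb⟩
    refine ⟨ha.and hb, fun h => ?_⟩
    rcases hQ.mem_or_mem (x := ⟨a, ha⟩) (y := ⟨b, hb⟩) h with h | h
    · exact hna h
    · exact hnb h
  · intro a ha
    by_contra hcon
    have h1 : (⟨a, ha⟩ : BoolPart M) ∈ Q := by
      by_contra h; exact hcon (Or.inl ⟨ha, h⟩)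
    have h2 : (⟨∼a, ha.not⟩ : BoolPart M) ∈ Q := by
      by_contra h; exact hcon (Or.inr ⟨ha.not, h⟩)
    apply hTQ
    let x : BoolPart M := ⟨a, ha⟩
    let y : BoolPart M := ⟨∼a, ha.not⟩
    have h3 : x ⊔ y ∈ Q := Order.Ideal.sup_mem h1 h2
    have h4 : x ⊔ y = bT := Subtype.ext ha
    rwa [h4] at h3

theorem lift_left {a b x y : M} (ha : IsB a) (hb : IsB b) (h : a ⋏ x = a ⋏ y) :
    (a ⋏ b) ⋏ x = (a ⋏ b) ⋏ y := by
  rw [ha.and_comm hb, CAlgebra.and_assoc, h, CAlgebra.and_assoc]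

theorem lift_right {a b x y : M} (h : b ⋏ x = b ⋏ y) :
    (a ⋏ b) ⋏ x = (a ⋏ b) ⋏ y := by
  rw [CAlgebra.and_assoc, h, CAlgebra.and_assoc]

/-- The congruence of a filter of Boolean elements. -/
def congOf (P : M → Prop) (hB : ∀ a, P a → IsB a) (hT : P T)
    (hand : ∀ a b, P a → P b → P (a ⋏ b)) : AdaCongruence M where
  rel x y := ∃ a, P a ∧ a ⋏ x = a ⋏ y
  refl x := ⟨T, hT, rfl⟩
  symm := by
    rintro x y ⟨a, ha, h⟩
    exact ⟨a, ha, h.symm⟩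
  trans := by
    rintro x y z ⟨a, ha, h⟩ ⟨b, hb, h'⟩
    exact ⟨a ⋏ b, hand _ _ ha hb, (lift_left (hB _ ha) (hB _ hb) h).trans (lift_right h')⟩
  or_compat := by
    rintro x y z w ⟨a, ha, h⟩ ⟨b, hb, h'⟩
    exact ⟨a ⋏ b, hand _ _ ha hb, ((hB _ ha).and (hB _ hb)).or_cong
      (lift_left (hB _ ha) (hB _ hb) h) (lift_right h')⟩
  and_compat := by
    rintro x y z w ⟨a, ha, h⟩ ⟨b, hb, h'⟩
    exact ⟨a ⋏ b, hand _ _ ha hb, ((hB _ ha).and (hB _ hb)).and_cong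
      (lift_left (hB _ ha) (hB _ hb) h) (lift_right h')⟩
  not_compat := by
    rintro x y ⟨a, ha, h⟩
    exact ⟨a, ha, not_cong h⟩
  down_compat := by
    rintro x y ⟨a, ha, h⟩
    exact ⟨a, ha, by rw [down_and a x, h, ← down_and]⟩

theorem congOf_max (P : M → Prop) (hB : ∀ a, P a → IsB a) (hT : P T)
    (hand : ∀ a b, P a → P b → P (a ⋏ b)) (hF : ¬ P F) (hu : ∀ a, IsB a → P a ∨ P (∼a)) :
    (congOf P hB hT hand).IsMaximal := by
  have hTF : ¬ (congOf P hB hT hand).rel T F := by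
    rintro ⟨a, ha, h⟩
    rw [and_T, (hB a ha).and_F] at h
    exact hF (h ▸ ha)
  have hTU : ¬ (congOf P hB hT hand).rel T U := fun h => by
    have := (congOf P hB hT hand).down_compat h
    rw [down_T, down_U] at this
    exact hTF this
  refine ⟨hTF, hTU, fun h => ?_, fun α => ?_⟩
  · have := (congOf P hB hT hand).not_compat h
    rw [not_F, not_U] at this
    exact hTU this
  · rcases hu _ (isB_down α) with h | h
    · exact Or.inl ⟨_, h, down_T_eq α⟩
    rcases hu _ (isB_down (∼α)) with h' | h'
    · exact Or.inr (Or.inl ⟨_, h', down_not_F_eq α⟩)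
    · exact Or.inr (Or.inr ⟨und α, hand _ _ h h', und_and_U α⟩)

theorem m_inj (α β : M) (h : ∀ θ : AdaCongruence M, θ.IsMaximal → θ.rel α β) : α = β := by
  by_contra hne
  obtain ⟨P, hB, hI, hT, hF, hand, hu⟩ := exists_prime (fun a : M => a ⋏ α = a ⋏ β)
    (by simp only [F_and]) (by simpa only [T_and] using hne)
    (fun a b ha hb h => lift_left ha hb h)
    (fun a b ha hb h h' => by
      rw [CAlgebra.or_and, CAlgebra.or_and, h, h'])
  obtain ⟨a, ha, h⟩ := h _ (congOf_max P hB hT hand hF hu)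
  exact hI a ha h

end ada

section cset
variable {S : Type u} {M : Type v} [Ada M] [CSet S M]

open CSet

local infixl:70 "⋏" => CAlgebra.cand
local infixl:65 "⋎" => CAlgebra.cor
local prefix:80 "∼" => CAlgebra.cnot

theorem act_all {β : M} {s t : S} (h : act β s t = act β t t) (x : S) :
    act β s x = act β t x := by
  rw [← pos_red β s t x, h, pos_red]

theorem act_or (α β : M) (s t : S) : act (α ⋎ β) s t = act α s (act β s t) := by
  rw [← CAlgebra.not_not (α ⋎ β), not_ax, not_or, and_ax, not_ax, not_ax]

theorem act_T (s t : S) : act (T : M) s t = s := by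
  rw [← not_F, not_ax, F_ax]

theorem erel_equiv (θ : AdaCongruence M) : Equivalence (Erel S M θ.rel) where
  refl s := ⟨T, θ.refl _, rfl⟩
  symm := by
    rintro s t ⟨β, hβ, h⟩
    exact ⟨β, hβ, (act_all h s).symm⟩
  trans := by
    rintro s t r ⟨β, hβ, h⟩ ⟨γ, hγ, h'⟩
    refine ⟨β ⋏ γ, ?_, ?_⟩
    · have := θ.and_compat hβ hγ
      rwa [and_T] at this
    · rw [act_all (CSet.and_compat β γ s t h) r, and_ax, act_all h' r, ← and_ax]

theorem erel_T (θ : AdaCongruence M) (α : M) (s t : S) (h : θ.rel α T) :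
    Erel S M θ.rel (act α s t) s := ⟨α, h, pos_red _ _ _ _⟩

theorem erel_F (θ : AdaCongruence M) (α : M) (s t : S) (h : θ.rel α F) :
    Erel S M θ.rel (act α s t) t := by
  refine ⟨∼α, ?_, ?_⟩
  · have := θ.not_compat h
    rwa [not_F] at this
  · rw [not_ax, not_ax, neg_red]

theorem erel_U (θ : AdaCongruence M) (α : M) (s t : S) (h : θ.rel α U) :
    Erel S M θ.rel (act α s t) (bot (S := S) (M := M)) := by
  refine ⟨und α, ?_, ?_⟩
  · have h1 := θ.not_compat (θ.down_compat h)
    have h2 := θ.not_compat (θ.down_compat (θ.not_compat h))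
    rw [not_U] at h2
    rw [down_U, not_F] at h1 h2
    have := θ.and_compat h1 h2
    rwa [and_T] at this
  · rw [← pos_red (und α) (act α s t) t, ← and_ax, und_and_U, and_ax, U_ax, pos_red]

theorem erel_cong (θ : AdaCongruence M) (hθ : θ.IsMaximal) (s t u v : S) (α β : M)
    (hs : Erel S M θ.rel s t) (hu : Erel S M θ.rel u v) (h : θ.rel α β) :
    Erel S M θ.rel (act α s u) (act β t v) := by
  have E := erel_equiv (S := S) θ
  rcases hθ.2.2.2 α with h1 | h1 | h1
  · exact E.trans (erel_T θ α s u h1)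
      (E.trans hs (E.symm (erel_T θ β t v (θ.trans (θ.symm h) h1))))
  · exact E.trans (erel_F θ α s u h1)
      (E.trans hu (E.symm (erel_F θ β t v (θ.trans (θ.symm h) h1))))
  · exact E.trans (erel_U θ α s u h1)
      (E.symm (erel_U θ β t v (θ.trans (θ.symm h) h1)))

theorem s_inj (s t : S) (h : ∀ θ : AdaCongruence M, θ.IsMaximal → Erel S M θ.rel s t) :
    s = t := by
  by_contra hne
  obtain ⟨P, hB, hI, hT, hF, hand, hu⟩ := exists_prime
    (fun a : M => act a s t = act a t t)
    (by simp only [F_ax]) (by simpa only [act_T] using hne)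
    (fun a b _ _ h => CSet.and_compat a b s t h)
    (fun a b _ _ h h' => by
      rw [act_or, act_or, h', act_all h])
  obtain ⟨β, ⟨a, ha, hab⟩, h⟩ := h _ (congOf_max P hB hT hand hF hu)
  apply hI a ha
  rw [and_T] at hab
  change act a s t = act a t t
  rw [← hab, and_ax, h, ← and_ax]

end cset

end CHelp

end Helpers

/-- Every C-set (S⊥, M) with M an ada is a subdirect product of basic
C-sets: for every maximal congruence θ on M (so that M/θ ≅ 3), E_θ is an equivalence
relation, (E_θ, θ) is a C-set congruence (so the canonical two-sorted map into the
product of the quotients (S⊥/E_θ, M/θ) is a well-defined homomorphism, whose coordinate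
projections are the surjective quotient maps), each quotient is a basic C-set (the
induced action is the basic one), and the map is injective in both sorts. -/
theorem cset_subdirect_of_basic (S : Type u) (M : Type v) [Ada M] [CSet S M] :
    -- each E_θ is an equivalence, so the quotient S⊥/E_θ is well defined
    (∀ θ : AdaCongruence M, θ.IsMaximal → Equivalence (Erel S M θ.rel)) ∧
    -- (E_θ, θ) is a C-set congruence: the canonical map is a two-sorted homomorphism
    (∀ θ : AdaCongruence M, θ.IsMaximal →
      ∀ (s t u v : S) (α β : M), Erel S M θ.rel s t → Erel S M θ.rel u v → θ.rel α β →
        Erel S M θ.rel (CSet.act α s u) (CSet.act β t v)) ∧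
    -- each quotient (S⊥/E_θ, M/θ) is a basic C-set: the induced action is
    -- T[a,b] = a, F[a,b] = b, U[a,b] = ⊥ on classes
    (∀ θ : AdaCongruence M, θ.IsMaximal → ∀ (α : M) (s t : S),
      (θ.rel α CAlgebraTFU.T → Erel S M θ.rel (CSet.act α s t) s) ∧
      (θ.rel α CAlgebraTFU.F → Erel S M θ.rel (CSet.act α s t) t) ∧
      (θ.rel α CAlgebraTFU.U →
        Erel S M θ.rel (CSet.act α s t) (CSet.bot (S := S) (M := M)))) ∧
    -- the canonical map is injective in the S-sort
    (∀ s t : S, (∀ θ : AdaCongruence M, θ.IsMaximal → Erel S M θ.rel s t) → s = t) ∧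
    -- the canonical map is injective in the M-sort
    (∀ α β : M, (∀ θ : AdaCongruence M, θ.IsMaximal → θ.rel α β) → α = β) := by
  exact ⟨fun θ _ => CHelp.erel_equiv θ, fun θ hθ => CHelp.erel_cong θ hθ,
    fun θ _ α s t => ⟨CHelp.erel_T θ α s t, CHelp.erel_F θ α s t, CHelp.erel_U θ α s t⟩,
    CHelp.s_inj, CHelp.m_inj⟩
end

section
/- Every agreeable B-set is a subdirect product of basic agreeable B-sets: there is an embedding into a product of basic agreeable B-sets (injective in both sorts, preserving the action, the Boolean operations and the operation *) whose coordinate projections are surjective in both sorts. -/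
/-- A B-set: a set with an if-then-else action of a Boolean algebra
(F = ⊥, T = ⊤, ¬ = complement). -/
class BSet (S : Type) (Q : Type) [BooleanAlgebra Q] where
  act : Q → S → S → S
  ax1 : ∀ (α : Q) (a : S), act α a a = a
  ax2 : ∀ (α : Q) (a b c : S), act α (act α a b) c = act α a c
  ax3 : ∀ (α : Q) (a b c : S), act α a (act α b c) = act α a c
  ax4 : ∀ (a b : S), act ⊥ a b = b
  ax5 : ∀ (α : Q) (a b : S), act αᶜ a b = act α b a
  ax6 : ∀ (α β : Q) (a b : S), act (α ⊓ β) a b = act α (act β a b) b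

/-- An agreeable B-set: a B-set with an equality test * : S × S → Q, where the action of
Q on itself is α[β,γ] = (α ⊓ β) ⊔ (αᶜ ⊓ γ). -/
class AgreeableBSet (S : Type) (Q : Type) [BooleanAlgebra Q] extends BSet S Q where
  star : S → S → Q
  ab1 : ∀ s : S, star s s = ⊤
  ab2 : ∀ s t : S, act (star s t) s t = t
  ab3 : ∀ (α : Q) (s t u v : S),
    star (act α s t) (act α u v) = (α ⊓ star s u) ⊔ (αᶜ ⊓ star t v)

theorem sep_aux {Q : Type} [BooleanAlgebra Q] {a b : Q} (h : ¬ a ≤ b) :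
    ∃ J : Order.Ideal Q, J.IsPrime ∧ b ∈ J ∧ a ∉ J := by
  have hd : Disjoint ((Order.PFilter.principal a : Order.PFilter Q) : Set Q)
      ((Order.Ideal.principal b : Order.Ideal Q) : Set Q) := by
    rw [Set.disjoint_left]
    intro x hx hy
    have h1 : a ≤ x := Order.PFilter.mem_principal.1 hx
    have h2 : x ≤ b := Order.Ideal.mem_principal.1 hy
    exact h (h1.trans h2)
  obtain ⟨J, hJ, hle, hdis⟩ := DistribLattice.prime_ideal_of_disjoint_filter_ideal hd
  refine ⟨J, hJ, hle (Order.Ideal.mem_principal.2 le_rfl), fun ha => ?_⟩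
  exact Set.disjoint_left.1 hdis (Order.PFilter.mem_principal.2 le_rfl) ha

section
variable {S Q : Type} [BooleanAlgebra Q] [AgreeableBSet S Q]
open BSet AgreeableBSet

theorem star_symm_aux (s t : S) : (star s t : Q) ≤ star t s := by
  have h := ab3 (star s t : Q) s t s s
  rw [ab2, ax1, ab1, inf_top_eq] at h
  rw [h]; exact le_sup_left

theorem star_trans_aux (s t u : S) : (star s t : Q) ⊓ star t u ≤ star s u := by
  have h := ab3 (star s t : Q) s t u u
  rw [ab2, ax1] at h
  rw [h, inf_sup_left, ← inf_assoc, ← inf_assoc, inf_idem, inf_compl_self, bot_inf_eq, sup_bot_eq]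
  exact inf_le_right

theorem star_act_aux (α : Q) (s t : S) : α ≤ star (act α s t) s := by
  have h := ab3 α s t s s
  rw [ax1, ab1, inf_top_eq] at h
  rw [h]; exact le_sup_left

theorem star_act_aux' (α : Q) (s t : S) : αᶜ ≤ star (act α s t) t := by
  have h := ab3 α s t t t
  rw [ax1, ab1, inf_top_eq] at h
  rw [h]; exact le_sup_right

theorem star_top_aux (s t : S) (h : (star s t : Q) = ⊤) : s = t := by
  have h2 := ab2 (Q := Q) s t
  rw [h, ← compl_bot, ax5, ax4] at h2
  exact h2

/-- The congruence on S induced by a prime ideal. -/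
def primeSetoid (S : Type) {Q : Type} [BooleanAlgebra Q] [AgreeableBSet S Q]
    (J : {J : Order.Ideal Q // J.IsPrime}) : Setoid S where
  r s t := (star s t : Q)ᶜ ∈ J.1
  iseqv := by
    refine ⟨fun s => ?_, fun {s t} h => ?_, fun {s t u} h1 h2 => ?_⟩
    · rw [ab1, compl_top]; exact J.1.bot_mem
    · exact J.1.lower (compl_le_compl (star_symm_aux s t)) h
    · refine J.1.lower (compl_le_compl (star_trans_aux s t u)) ?_
      rw [compl_inf]
      exact Order.Ideal.sup_mem h1 h2

end

/-- Every agreeable B-set is a subdirect product of basic agreeable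
B-sets: there is a two-sorted embedding (f, g) into a product of basic agreeable B-sets
(S_i, 2), with 2 realized as `Bool`, which is injective in both sorts, preserves the
action (which is coordinatewise the basic action), the Boolean operations, and the
operation * (which is coordinatewise the basic equality test), and whose coordinate
projections are surjective in both sorts. -/
theorem agreeable_bset_subdirect (S Q : Type) [BooleanAlgebra Q] [AgreeableBSet S Q] :
    ∃ (I : Type) (Sf : I → Type) (f : S → ∀ i, Sf i) (g : Q → I → Bool),
      Function.Injective f ∧
      Function.Injective g ∧
      -- g is coordinatewise a Boolean algebra homomorphism into 2 = Bool
      (∀ (α β : Q) (i : I), g (α ⊓ β) i = (g α i && g β i)) ∧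
      (∀ (α β : Q) (i : I), g (α ⊔ β) i = (g α i || g β i)) ∧
      (∀ (α : Q) (i : I), g αᶜ i = !(g α i)) ∧
      (∀ i : I, g ⊤ i = true) ∧
      (∀ i : I, g ⊥ i = false) ∧
      -- the action is preserved and is coordinatewise the basic action
      (∀ (α : Q) (s t : S) (i : I),
        f (BSet.act α s t) i = cond (g α i) (f s i) (f t i)) ∧
      -- the equality test is preserved and is coordinatewise the basic one
      (∀ (s t : S) (i : I), g (AgreeableBSet.star s t) i = true ↔ f s i = f t i) ∧
      -- the coordinate projections are surjective in both sorts
      (∀ i : I, Function.Surjective (fun s : S => f s i)) ∧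
      (∀ i : I, Function.Surjective (fun α : Q => g α i)) := by
  classical
  have hc : ∀ (i : {J : Order.Ideal Q // J.IsPrime}) (a : Q), aᶜ ∈ i.1 ↔ a ∉ i.1 := by
    intro i a
    have := i.2
    constructor
    · intro h1 h2
      have := Order.Ideal.sup_mem h2 h1
      rw [sup_compl_eq_top] at this
      exact i.2.toIsProper.top_notMem this
    · intro h
      exact (i.2.mem_or_compl_mem (x := a)).resolve_left h
  have hq : ∀ (i : {J : Order.Ideal Q // J.IsPrime}) (s t : S),
      (Quotient.mk (primeSetoid S i) s = Quotient.mk (primeSetoid S i) t) ↔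
        (AgreeableBSet.star s t : Q)ᶜ ∈ i.1 := fun i s t => Quotient.eq
  have htop : ∀ i : {J : Order.Ideal Q // J.IsPrime}, (⊤ : Q) ∉ i.1 :=
    fun i => i.2.toIsProper.top_notMem
  refine ⟨{J : Order.Ideal Q // J.IsPrime}, fun i => Quotient (primeSetoid S i),
    fun s i => Quotient.mk _ s, fun a i => decide (a ∉ i.1), ?_, ?_, ?_, ?_, ?_, ?_, ?_, ?_, ?_,
    ?_, ?_⟩
  · intro s t h
    apply star_top_aux (Q := Q)
    by_contra hne
    obtain ⟨J, hJ, h1, -⟩ := sep_aux (a := (⊤ : Q)) (b := AgreeableBSet.star s t)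
      (fun h => hne (top_le_iff.1 h))
    have := (hq ⟨J, hJ⟩ s t).1 (congrFun h ⟨J, hJ⟩)
    exact (hc ⟨J, hJ⟩ _).1 this h1
  · intro a b h
    have key : ∀ i : {J : Order.Ideal Q // J.IsPrime}, a ∈ i.1 ↔ b ∈ i.1 := by
      intro i
      have := congrFun h i
      simpa [not_iff_not] using this
    apply le_antisymm
    · by_contra hn
      obtain ⟨J, hJ, h1, h2⟩ := sep_aux hn
      exact h2 ((key ⟨J, hJ⟩).2 h1)
    · by_contra hn
      obtain ⟨J, hJ, h1, h2⟩ := sep_aux hn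
      exact h2 ((key ⟨J, hJ⟩).1 h1)
  · intro a b i
    have : a ⊓ b ∈ i.1 ↔ a ∈ i.1 ∨ b ∈ i.1 :=
      ⟨fun h => i.2.mem_or_mem h, fun h => h.elim (i.1.lower inf_le_left) (i.1.lower inf_le_right)⟩
    simp [this]
  · intro a b i
    simp only [Order.Ideal.sup_mem_iff]
    by_cases h1 : a ∈ i.1 <;> by_cases h2 : b ∈ i.1 <;> simp [h1, h2]
  · intro a i
    simp [hc]
  · intro i
    simp [htop i]
  · intro i
    simp
  · intro a s t i
    by_cases h : a ∈ i.1
    · simp only [h, not_true_eq_false, decide_false, cond_false]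
      refine (hq _ _ _).2 (i.1.lower ?_ h)
      rw [compl_le_iff_compl_le]
      exact star_act_aux' a s t
    · simp only [h, not_false_eq_true, decide_true, cond_true]
      exact (hq _ _ _).2 (i.1.lower (compl_le_compl (star_act_aux a s t)) ((hc _ _).2 h))
  · intro s t i
    rw [hq, hc, decide_eq_true_iff]
  · intro i
    exact Quotient.mk_surjective
  · intro i b
    cases b
    · exact ⟨⊥, by simp⟩
    · exact ⟨⊤, by simp [htop i]⟩
end

section
/- For every C-algebra M with T, F, U, the pair (M, M), with M viewed as a pointed set with base point U and with action α⟦β, γ⟧ = (α ∧ β) ∨ (¬α ∧ γ), is a C-set; that is, for all α, β, γ, δ, ρ, ω ∈ M: U⟦β, γ⟧ = U; F⟦β, γ⟧ = γ; (¬α)⟦β, γ⟧ = α⟦γ, β⟧; α⟦α⟦β, γ⟧, δ⟧ = α⟦β, δ⟧; α⟦β, α⟦γ, δ⟧⟧ = α⟦β, δ⟧; (α ∧ β)⟦γ, δ⟧ = α⟦β⟦γ, δ⟧, δ⟧; α⟦β⟦γ, δ⟧, β⟦ρ, ω⟧⟧ = β⟦α⟦γ, ρ⟧, α⟦δ, ω⟧⟧;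 and α⟦γ, δ⟧ = α⟦δ, δ⟧ implies (α ∧ β)⟦γ, δ⟧ = (α ∧ β)⟦δ, δ⟧. -/
universe u v

/-- The if-then-else action of the C-set (M, M): α⟦β, γ⟧ = (α ∧ β) ∨ (¬α ∧ γ). -/
def dact {M : Type v} [CAlgebraTFU M] (α β γ : M) : M :=
  CAlgebra.cor (CAlgebra.cand α β) (CAlgebra.cand (CAlgebra.cnot α) γ)

namespace CProof
open CAlgebra CAlgebraTFU

local notation:70 x:70 "⋏" y:71 => CAlgebra.cand x y
local notation:65 x:65 "⋎" y:66 => CAlgebra.cor x y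
local notation:max "∼" x:max => CAlgebra.cnot x

section
variable {M : Type v} [CAlgebraTFU M]

theorem n_or (a b : M) : ∼(a ⋎ b) = ∼a ⋏ ∼b := by
  rw [← CAlgebra.not_not (∼a ⋏ ∼b), CAlgebra.not_and, CAlgebra.not_not, CAlgebra.not_not]

theorem n_inj {a b : M} (h : ∼a = ∼b) : a = b := by
  rw [← CAlgebra.not_not a, h, CAlgebra.not_not]

theorem n_F : ∼(F : M) = T := by
  have h := n_or (F : M) (∼T)
  rw [F_or, CAlgebra.not_not, and_T] at h
  exact h.symm

theorem n_T : ∼(T : M) = F := by rw [← n_F, CAlgebra.not_not]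

theorem o_assoc (a b c : M) : a ⋎ b ⋎ c = a ⋎ (b ⋎ c) := by
  apply n_inj; simp only [n_or, CAlgebra.and_assoc]

theorem o_distrib (a b c : M) : a ⋎ b ⋏ c = (a ⋎ b) ⋏ (a ⋎ c) := by
  apply n_inj; rw [n_or, CAlgebra.not_and, CAlgebra.not_and, n_or, n_or, and_or_distrib]

theorem a_or (a b c : M) : a ⋏ b ⋎ c = (a ⋎ c) ⋏ (∼a ⋎ (b ⋎ c)) := by
  apply n_inj; rw [n_or, CAlgebra.not_and, CAlgebra.not_and, n_or, n_or, n_or, or_and]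

theorem absorbDual (a b : M) : a ⋏ (a ⋎ b) = a := by
  apply n_inj; simp only [n_or, CAlgebra.not_and, absorb]

theorem T_or (a : M) : T ⋎ a = T := by
  apply n_inj; simp only [n_or, n_T, F_and]

theorem oo (a : M) : a ⋎ a = a := by
  have h := absorb a (T : M); rwa [and_T] at h

theorem aa (a : M) : a ⋏ a = a := by
  apply n_inj; rw [CAlgebra.not_and, oo]

/-- a ∨ b = a ∨ (¬a ∧ b) -/
theorem L1 (a b : M) : a ⋎ ∼a ⋏ b = a ⋎ b := by
  have h := or_and a b T; simp only [and_T] at h; exact h.symm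

theorem L1d (a b : M) : a ⋏ (∼a ⋎ b) = a ⋏ b := by
  apply n_inj; simp only [n_or, CAlgebra.not_and, L1]

theorem o_T (a : M) : a ⋎ ∼a = a ⋎ T := by
  have h := L1 a (T : M); rwa [and_T] at h

theorem a_n (a : M) : a ⋏ ∼a = a ⋏ F := by
  have h := L1d a (F : M); rwa [or_F] at h

theorem nF_aux (a : M) : a ⋏ F ⋎ ∼a ⋏ F = a ⋏ F := by
  rw [a_or, L1, or_F, F_or, absorb, a_n]

theorem F_comm (a b : M) : a ⋏ F ⋎ b ⋏ F = b ⋏ F ⋎ a ⋏ F := by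
  have h := quasi_comm (a ⋏ F) (b ⋏ F)
  simpa only [CAlgebra.and_assoc, F_and] using h

theorem nF (a : M) : ∼a ⋏ F = a ⋏ F := by
  have h := nF_aux (∼a)
  rw [CAlgebra.not_not, F_comm, nF_aux] at h
  exact h.symm

theorem n_a (a : M) : ∼a ⋏ a = a ⋏ F := by
  have h := a_n (∼a); rwa [CAlgebra.not_not, nF] at h

theorem a_n_l (a b : M) : a ⋏ (∼a ⋏ b) = a ⋏ F := by
  rw [← CAlgebra.and_assoc, a_n, CAlgebra.and_assoc, F_and]

theorem n_a_l (a b : M) : ∼a ⋏ (a ⋏ b) = a ⋏ F := by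
  rw [← CAlgebra.and_assoc, n_a, CAlgebra.and_assoc, F_and]

theorem Fo (a b : M) : a ⋏ F ⋎ a ⋏ b = a ⋏ b := by
  rw [← and_or_distrib, F_or]

theorem oF (a b : M) : a ⋏ b ⋎ a ⋏ F = a ⋏ b := by
  rw [← and_or_distrib, or_F]

theorem a_orT (a b : M) : a ⋏ (b ⋎ T) = a ⋏ b ⋎ a := by
  rw [and_or_distrib, and_T]

theorem key0 (a b c : M) :
    a ⋏ (b ⋏ c) ⋎ a ⋏ (∼b ⋏ (a ⋏ c)) = a ⋏ (b ⋏ c) ⋎ a ⋏ (∼b ⋏ c) := by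
  have h1 : a ⋏ (b ⋎ T) ⋏ c = a ⋏ (b ⋏ c) ⋎ a ⋏ (∼b ⋏ c) := by
    rw [CAlgebra.and_assoc, or_and, T_and, and_or_distrib]
  rw [← h1, a_orT, or_and, CAlgebra.not_and, or_and, CAlgebra.not_not, n_a_l, Fo,
    CAlgebra.and_assoc]

theorem key1 (a b : M) : a ⋏ (∼b ⋏ (a ⋏ b)) = a ⋏ (∼b ⋏ F) := by
  have h := key0 a b b
  rw [aa, n_a, ← CAlgebra.and_assoc a b F] at h
  have hb := oF (a ⋏ b) T
  rw [and_T] at hb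
  rw [hb] at h
  have h2 := congrArg (fun z => ∼(a ⋏ b) ⋏ z) h
  simp only [and_or_distrib] at h2
  have e : ∼(a ⋏ b) ⋏ (a ⋏ (∼b ⋏ (a ⋏ b))) = a ⋏ (∼b ⋏ (a ⋏ b)) := by
    rw [CAlgebra.not_and, or_and, CAlgebra.not_not, n_a_l, Fo]
    have := aa (a ⋏ ∼b)
    calc a ⋏ (∼b ⋏ (a ⋏ (∼b ⋏ (a ⋏ b)))) = ((a ⋏ ∼b) ⋏ (a ⋏ ∼b)) ⋏ (a ⋏ b) := by
          simp only [CAlgebra.and_assoc]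
      _ = _ := by rw [this, CAlgebra.and_assoc]
  rw [e, n_a, CAlgebra.and_assoc, ← nF b, ← and_or_distrib, Fo] at h2
  exact h2

theorem key2 (a b : M) : a ⋏ (∼b ⋏ a) = a ⋏ ∼b := by
  have h := congrArg (fun z => (a ⋏ ∼b) ⋏ z) (key0 a b T)
  simp only [and_or_distrib, and_T] at h
  rw [← CAlgebra.and_assoc a (∼b) a, ← CAlgebra.and_assoc (a ⋏ ∼b) (a ⋏ ∼b) a, aa,
    CAlgebra.and_assoc a (∼b) (a ⋏ b), key1] at h
  simp only [CAlgebra.and_assoc] at h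
  rw [← and_or_distrib, Fo] at h
  rw [h]
  have := aa (a ⋏ ∼b)
  rw [CAlgebra.and_assoc] at this
  rw [← and_or_distrib]
  have := Fo (∼b) (T : M)
  rw [and_T] at this
  rw [this]

theorem aba (a b : M) : a ⋏ (b ⋏ a) = a ⋏ b := by
  have := key2 a (∼b); rwa [CAlgebra.not_not] at this

theorem oba (a b : M) : a ⋎ (b ⋎ a) = a ⋎ b := by
  apply n_inj; simp only [n_or, aba]

theorem aba_l (a b c : M) : a ⋏ (b ⋏ (a ⋏ c)) = a ⋏ (b ⋏ c) := by
  rw [← CAlgebra.and_assoc b, ← CAlgebra.and_assoc a, aba, CAlgebra.and_assoc]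

theorem abn_l (a b c : M) : a ⋏ (b ⋏ (∼a ⋏ c)) = a ⋏ (b ⋏ F) := by
  rw [← aba_l, a_n_l, aba_l]

theorem nba_l (a b c : M) : ∼a ⋏ (b ⋏ (a ⋏ c)) = ∼a ⋏ (b ⋏ F) := by
  have := abn_l (∼a) b c; rwa [CAlgebra.not_not] at this

/-- normal form -/
theorem N (a x y : M) : a ⋏ x ⋎ ∼a ⋏ y = (a ⋎ y) ⋏ (∼a ⋎ x) := by
  rw [a_or, L1]
  congr 1
  rw [← o_assoc, o_distrib, o_assoc, oba, absorbDual]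

theorem Rz0 (a x y z : M) :
    (a ⋏ x ⋎ ∼a ⋏ y) ⋏ z = ∼a ⋏ (y ⋏ z) ⋎ a ⋏ (x ⋏ z) := by
  have e : (∼a ⋎ x) ⋏ z = ∼a ⋏ z ⋎ a ⋏ (x ⋏ z) := by
    rw [or_and, CAlgebra.not_not]
  have e1 : (a ⋎ y) ⋏ (∼a ⋏ z) = ∼a ⋏ (y ⋏ z) := by
    rw [or_and, a_n_l, aba_l, ← nF, Fo]
  have e2 : (a ⋎ y) ⋏ (a ⋏ (x ⋏ z)) = a ⋏ (x ⋏ z) ⋎ ∼a ⋏ (y ⋏ F) := by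
    rw [or_and, nba_l, ← CAlgebra.and_assoc a a, aa]
  rw [N, CAlgebra.and_assoc, e, and_or_distrib, e1, e2]
  have e3 : ∼a ⋏ (y ⋏ z) = ∼a ⋏ (y ⋏ z) ⋎ ∼a ⋏ (y ⋏ F) := by
    rw [← and_or_distrib, oF]
  rw [e3, o_assoc, oba, ← o_assoc, ← e3]

theorem R_comm (a x y : M) : a ⋏ x ⋎ ∼a ⋏ y = ∼a ⋏ y ⋎ a ⋏ x := by
  have := Rz0 a x y T
  simpa only [and_T] using this

theorem Rz (a x y z : M) :
    (a ⋏ x ⋎ ∼a ⋏ y) ⋏ z = a ⋏ (x ⋏ z) ⋎ ∼a ⋏ (y ⋏ z) := by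
  rw [Rz0, R_comm]

theorem aR (a x y : M) : a ⋏ (a ⋏ x ⋎ ∼a ⋏ y) = a ⋏ x := by
  rw [and_or_distrib, a_n_l, ← CAlgebra.and_assoc, aa, oF]

theorem nR (a x y : M) : ∼a ⋏ (a ⋏ x ⋎ ∼a ⋏ y) = ∼a ⋏ y := by
  rw [and_or_distrib, n_a_l, ← CAlgebra.and_assoc, aa, ← nF, Fo]

theorem eR (a z : M) : (a ⋎ T) ⋏ z = a ⋏ z ⋎ ∼a ⋏ z := by
  rw [or_and, T_and]

theorem eRR (a x y : M) : (a ⋎ T) ⋏ (a ⋏ x ⋎ ∼a ⋏ y) = a ⋏ x ⋎ ∼a ⋏ y := by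
  rw [eR, aR, nR]

theorem e_comm (a b : M) : (a ⋎ T) ⋏ (b ⋎ T) = (b ⋎ T) ⋏ (a ⋎ T) := by
  apply n_inj; simp only [CAlgebra.not_and, n_or, n_T]; exact F_comm _ _

/-- a ∧ (b-conditional of a-conditionals) -/
theorem nest (a b c d r w : M) :
    a ⋏ (b ⋏ (a ⋏ c ⋎ ∼a ⋏ r) ⋎ ∼b ⋏ (a ⋏ d ⋎ ∼a ⋏ w)) = a ⋏ (b ⋏ c ⋎ ∼b ⋏ d) := by
  rw [and_or_distrib, ← aba_l a b, aR, aba_l, ← aba_l a (∼b), aR, aba_l, and_or_distrib]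

theorem nestNeg (a b c d r w : M) :
    ∼a ⋏ (b ⋏ (a ⋏ c ⋎ ∼a ⋏ r) ⋎ ∼b ⋏ (a ⋏ d ⋎ ∼a ⋏ w)) = ∼a ⋏ (b ⋏ r ⋎ ∼b ⋏ w) := by
  rw [and_or_distrib, ← aba_l (∼a) b, nR, aba_l, ← aba_l (∼a) (∼b), nR, aba_l, and_or_distrib]

theorem eY (e b P Q : M) (hP : e ⋏ P = P) (hQ : e ⋏ Q = Q) :
    (b ⋎ T) ⋏ (e ⋏ (b ⋏ P ⋎ ∼b ⋏ Q)) = b ⋏ P ⋎ ∼b ⋏ Q := by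
  have h1 : b ⋏ (e ⋏ (b ⋏ P ⋎ ∼b ⋏ Q)) = b ⋏ P := by
    rw [← aba_l, aR, aba_l, hP]
  have h2 : ∼b ⋏ (e ⋏ (b ⋏ P ⋎ ∼b ⋏ Q)) = ∼b ⋏ Q := by
    rw [← aba_l, nR, aba_l, hQ]
  rw [eR, h1, h2]

theorem seven (a b c d r w : M) :
    a ⋏ (b ⋏ c ⋎ ∼b ⋏ d) ⋎ ∼a ⋏ (b ⋏ r ⋎ ∼b ⋏ w) =
      b ⋏ (a ⋏ c ⋎ ∼a ⋏ r) ⋎ ∼b ⋏ (a ⋏ d ⋎ ∼a ⋏ w) := by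
  rw [← nest a b c d r w, ← nestNeg a b c d r w, ← eR]
  have h := eY (a ⋎ T) b _ _ (eRR a c r) (eRR a d w)
  rw [← CAlgebra.and_assoc, e_comm, CAlgebra.and_assoc, eRR] at h
  exact h

end
end CProof

/-- For every C-algebra M with T, F, U, the pair (M, M) with base point U
and action α⟦β, γ⟧ = (α ∧ β) ∨ (¬α ∧ γ) is a C-set: all eight C-set axioms hold. -/
theorem MM_is_cset (M : Type v) [CAlgebraTFU M] :
    (∀ β γ : M, dact CAlgebraTFU.U β γ = CAlgebraTFU.U) ∧
    (∀ β γ : M, dact CAlgebraTFU.F β γ = γ) ∧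
    (∀ α β γ : M, dact (CAlgebra.cnot α) β γ = dact α γ β) ∧
    (∀ α β γ δ : M, dact α (dact α β γ) δ = dact α β δ) ∧
    (∀ α β γ δ : M, dact α β (dact α γ δ) = dact α β δ) ∧
    (∀ α β γ δ : M, dact (CAlgebra.cand α β) γ δ = dact α (dact β γ δ) δ) ∧
    (∀ α β γ δ ρ ω : M,
      dact α (dact β γ δ) (dact β ρ ω) = dact β (dact α γ ρ) (dact α δ ω)) ∧
    (∀ α β γ δ : M, dact α γ δ = dact α δ δ →
      dact (CAlgebra.cand α β) γ δ = dact (CAlgebra.cand α β) δ δ) := by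
  unfold dact
  have six : ∀ α β γ δ : M, dact (CAlgebra.cand α β) γ δ = dact α (dact β γ δ) δ := by
    intro a b c d
    unfold dact
    rw [CAlgebra.not_and, CAlgebra.or_and, CAlgebra.not_not, CAlgebra.and_or_distrib,
      CAlgebra.and_assoc, CProof.o_assoc]
    congr 1
    exact (CProof.R_comm a _ _).symm
  unfold dact at six
  refine ⟨?_, ?_, ?_, ?_, ?_, six, ?_, ?_⟩
  · intro b c
    rw [CAlgebraTFU.U_and, CAlgebraTFU.U_or]
  · intro b c
    rw [CAlgebraTFU.F_and, CProof.n_F, CAlgebraTFU.F_or, CAlgebraTFU.T_and]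
  · intro a b c
    rw [CAlgebra.not_not, CProof.R_comm]
  · intro a b c d
    rw [CProof.aR]
  · intro a b c d
    rw [CProof.nR]
  · intro a b c d r w
    exact CProof.seven a b c d r w
  · intro a b c d h
    have h1 := congrArg (CAlgebra.cand a) h
    rw [CProof.aR, CProof.aR] at h1
    rw [CAlgebra.and_assoc, CAlgebra.and_assoc, ← CProof.aba_l, h1, CProof.aba_l]
end

section
/- For every C-algebra M with T, F, U, the C-set (M, M) (base point U, action α⟦β, γ⟧ = (α ∧ β) ∨ (¬α ∧ γ)) is agreeable under the operation α * β = (α ∧ β) ∨ (¬α ∧ ¬β); that is, for all α, β, γ, δ, ρ ∈ M: (α*α)⟦α, U⟧ = α; U*α = U = α*U; (α*β)⟦α, β⟧ = (α*β)⟦β, β⟧; α⟦β, γ⟧ * α⟦δ, ρ⟧ = α⟦β*δ, γ*ρ⟧; and α*α = T together with α*β = U imply β = U. -/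
universe u v

/-- The equality test on the C-set (M, M): α * β = (α ∧ β) ∨ (¬α ∧ ¬β). -/
def dstar {M : Type v} [CAlgebraTFU M] (α β : M) : M :=
  CAlgebra.cor (CAlgebra.cand α β) (CAlgebra.cand (CAlgebra.cnot α) (CAlgebra.cnot β))

namespace CAux

open CAlgebra CAlgebraTFU

local notation:70 x:70 "⊙" y:71 => CAlgebra.cand x y
local notation:65 x:65 "⩖" y:66 => CAlgebra.cor x y
local notation:max "∼" x:max => CAlgebra.cnot x

variable {M : Type v} [CAlgebraTFU M]

theorem nn (x : M) : ∼(∼x) = x := CAlgebra.not_not x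
theorem nand (x y : M) : ∼(x ⊙ y) = ∼x ⩖ ∼y := CAlgebra.not_and x y
theorem nor (x y : M) : ∼(x ⩖ y) = ∼x ⊙ ∼y := by
  rw [← nn (∼x ⊙ ∼y), nand, nn, nn]
theorem aa (x y z : M) : x ⊙ y ⊙ z = x ⊙ (y ⊙ z) := CAlgebra.and_assoc x y z
theorem ninj {x y : M} (h : ∼x = ∼y) : x = y := by rw [← nn x, h, nn]
theorem oa (x y z : M) : x ⩖ y ⩖ z = x ⩖ (y ⩖ z) := by
  apply ninj; simp only [nor, aa]
theorem ld (x y z : M) : x ⊙ (y ⩖ z) = x ⊙ y ⩖ x ⊙ z := CAlgebra.and_or_distrib x y z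
theorem ld' (x y z : M) : x ⩖ (y ⊙ z) = (x ⩖ y) ⊙ (x ⩖ z) := by
  apply ninj; rw [nor, nand, ld, nand, nor, nor]
theorem rd (x y z : M) : (x ⩖ y) ⊙ z = x ⊙ z ⩖ ∼x ⊙ (y ⊙ z) := CAlgebra.or_and x y z
theorem rd' (x y z : M) : (x ⊙ y) ⩖ z = (x ⩖ z) ⊙ (∼x ⩖ (y ⩖ z)) := by
  apply ninj; rw [nor, nand, rd, nand, nor, nor, nor]
theorem ab (x y : M) : x ⩖ x ⊙ y = x := CAlgebra.absorb x y
theorem ab' (x y : M) : x ⊙ (x ⩖ y) = x := by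
  apply ninj; simp only [nor, nand, ab]
theorem qc (x y : M) : x ⊙ y ⩖ y ⊙ x = y ⊙ x ⩖ x ⊙ y := CAlgebra.quasi_comm x y
theorem qc' (x y : M) : (x ⩖ y) ⊙ (y ⩖ x) = (y ⩖ x) ⊙ (x ⩖ y) := by
  apply ninj; simp only [nor, nand, qc]
theorem Ta (x : M) : T ⊙ x = x := CAlgebraTFU.T_and x
theorem aT (x : M) : x ⊙ T = x := CAlgebraTFU.and_T x
theorem Fo (x : M) : F ⩖ x = x := CAlgebraTFU.F_or x
theorem oF (x : M) : x ⩖ F = x := CAlgebraTFU.or_F x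
theorem Fa (x : M) : F ⊙ x = F := CAlgebraTFU.F_and x
theorem Ua (x : M) : U ⊙ x = U := CAlgebraTFU.U_and x
theorem Uo (x : M) : U ⩖ x = U := CAlgebraTFU.U_or x
theorem nU : ∼(U : M) = U := CAlgebraTFU.not_U
theorem ai (x : M) : x ⊙ x = x := by
  have := ab' x F
  rwa [oF] at this
theorem oi (x : M) : x ⩖ x = x := by
  have := ab x T
  rwa [aT] at this
theorem on (x y : M) : x ⩖ ∼x ⊙ y = x ⩖ y := by
  have := rd x y T
  simp only [aT] at this
  exact this.symm
theorem an (x y : M) : x ⊙ (∼x ⩖ y) = x ⊙ y := by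
  apply ninj; simp only [nor, nand, on]
theorem aF (x : M) : x ⊙ ∼x = x ⊙ F := by
  have := an x F
  rwa [oF] at this
theorem aF' (x : M) : ∼x ⊙ x = ∼x ⊙ F := by
  have := aF (∼x)
  rwa [nn] at this
theorem FF1 (x : M) : x ⊙ F ⩖ ∼x ⊙ F = x ⊙ F := by
  rw [rd', Fo, on, oF, ab, aF]
theorem nF (x : M) : ∼x ⊙ F = x ⊙ F := by
  have h1 := FF1 x
  have h2 := FF1 (∼x)
  have h3 := qc x (∼x)
  rw [nn] at h2
  rw [aF, aF', h1, h2] at h3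
  exact h3.symm
theorem ea (x : M) : (x ⩖ ∼x) ⊙ x = x := by
  rw [rd, ai, ← aa, ai, on, oi]
theorem ec (x : M) : x ⩖ ∼x = ∼x ⩖ x := by
  apply ninj; rw [nor, nor, nn, aF, aF', nF]
theorem ea' (x : M) : (x ⩖ ∼x) ⊙ ∼x = ∼x := by
  have := ea (∼x)
  rwa [nn, ← ec] at this
theorem ed (x z : M) : (x ⩖ ∼x) ⊙ z = x ⊙ z ⩖ ∼x ⊙ z := by
  rw [rd, ← aa (∼x), ai]
theorem aba (x y : M) : x ⊙ (y ⊙ x) = x ⊙ y := by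
  have h := congrArg (fun t => x ⊙ t) (qc x y)
  simp only [ld] at h
  rw [← aa x x y, ai, ← aa x y x, ab] at h
  have h2 := ab (x ⊙ y ⊙ x) y
  have h3 : x ⊙ y ⊙ x ⊙ y = x ⊙ y := by
    rw [aa (x ⊙ y), ai]
  rw [h3] at h2
  rw [← aa, ← h2, ← h]
theorem abac (x y z : M) : x ⊙ (y ⊙ (x ⊙ z)) = x ⊙ (y ⊙ z) := by
  rw [← aa y, ← aa x, aba, aa]
theorem oUU (x : M) : x ⊙ U ⩖ ∼x ⊙ U = U := by
  have h := qc' x U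
  rwa [Uo, Ua, rd, Ua] at h
/-- first branch of a conditional -/
theorem c1 (a b c : M) : a ⊙ (a ⊙ b ⩖ ∼a ⊙ c) = a ⊙ b := by
  rw [ld, ← aa, ai, ← aa, aF, aa, Fa, ← ld, oF]
theorem c2 (a b c : M) : ∼a ⊙ (a ⊙ b ⩖ ∼a ⊙ c) = ∼a ⊙ c := by
  rw [ld, ← aa, ← aa, ai, aF', aa, Fa, ← ld, Fo]
theorem e_cond (a b c : M) : (a ⩖ ∼a) ⊙ (a ⊙ b ⩖ ∼a ⊙ c) = a ⊙ b ⩖ ∼a ⊙ c := by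
  rw [ed, c1, c2]
theorem comm (a b c : M) : a ⊙ b ⩖ ∼a ⊙ c = ∼a ⊙ c ⩖ a ⊙ b := by
  have hxy : (a ⊙ b) ⊙ (∼a ⊙ c) = a ⊙ (b ⊙ F) := by
    have h := abac a b (∼a ⊙ c)
    rw [← aa a (∼a) c, aF, aa, Fa, abac] at h
    rw [aa, h]
  have hyx : (∼a ⊙ c) ⊙ (a ⊙ b) = ∼a ⊙ (c ⊙ F) := by
    have h := abac (∼a) c (a ⊙ b)
    rw [← aa (∼a) a b, aF', aa, Fa, abac] at h
    rw [aa, h]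
  have key : ∀ x y : M, (x ⩖ y) ⊙ (y ⩖ x) = x ⊙ y ⩖ (x ⩖ y) := by
    intro x y
    rw [rd, ab', ld, ai, oa, on]
  have h := qc' (a ⊙ b) (∼a ⊙ c)
  rw [key, key, hxy, hyx, ← oa, ← oa, ← ld, ← ld] at h
  have k : ∀ z : M, z ⊙ F ⩖ z = z := by
    intro z
    have := ld z F T
    rwa [Fo, aT, eq_comm] at this
  rwa [k, k] at h
theorem ncond (a b c : M) : ∼(a ⊙ b ⩖ ∼a ⊙ c) = a ⊙ ∼b ⩖ ∼a ⊙ ∼c := by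
  rw [nor, nand, nand, nn, rd, nn, comm]
  congr 1
  · have := an (∼a) (∼c)
    rwa [nn] at this
  · rw [ld, ld, aba, ← ld, ab]
theorem andcond (a b c d r : M) : (a ⊙ b ⩖ ∼a ⊙ c) ⊙ (a ⊙ d ⩖ ∼a ⊙ r)
    = a ⊙ (b ⊙ d) ⩖ ∼a ⊙ (c ⊙ r) := by
  rw [← e_cond a b c, aa, ed, ← aa a, ← aa (∼a), c1, c2]
  congr 1
  · rw [aa, ← abac, c1, abac]
  · rw [aa, ← abac, c2, abac]

theorem p1 (α : M) : dact (dstar α α) α U = α := by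
  unfold dact dstar
  rw [ai, ai, ea, nor, nn, aF', aa, Fa]
  have := on α F
  rw [this, oF]
theorem p3 (α β : M) : dstar α β ⊙ α = dstar α β ⊙ β := by
  unfold dstar
  have h : ∼α ⊙ (∼β ⊙ α) = ∼α ⊙ (∼β ⊙ β) := by
    rw [← abac, aF', abac, aF']
  rw [rd, rd, aa, aa, aa, aa, aba, ai, h]
theorem p4 (α β γ δ ρ : M) :
    dstar (dact α β γ) (dact α δ ρ) = dact α (dstar β δ) (dstar γ ρ) := by
  unfold dstar dact
  rw [ncond, ncond, andcond, andcond, ld, ld, oa, oa, ← oa (∼α ⊙ (γ ⊙ ρ)), ← comm, oa]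
theorem p5 (α β : M) (h : dstar α α = T) (h' : dstar α β = U) : β = U := by
  unfold dstar at h h'
  rw [ai, ai] at h
  have h1 := c1 α β (∼β)
  have h2 := c2 α β (∼β)
  rw [h'] at h1 h2
  have h3 := congrArg CAlgebra.cnot h2
  rw [nand, nand, nn, nn, nU] at h3
  have h4 : ∼α ⊙ β = ∼α ⊙ U := by
    have e1 := an (∼α) β
    have e2 := an (∼α) U
    rw [nn] at e1 e2
    rw [← e1, ← e2, h3]
  rw [← Ta β, ← h, ed, ← h1, h4, oUU]

end CAux

/-- For every C-algebra M with T, F, U, the C-set (M, M) (base point U,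
action α⟦β, γ⟧ = (α ∧ β) ∨ (¬α ∧ γ)) is agreeable under α * β = (α ∧ β) ∨ (¬α ∧ ¬β):
all five agreeable C-set axioms hold. -/
theorem MM_is_agreeable (M : Type v) [CAlgebraTFU M] :
    (∀ α : M, dact (dstar α α) α CAlgebraTFU.U = α) ∧
    (∀ α : M, dstar CAlgebraTFU.U α = CAlgebraTFU.U ∧ dstar α CAlgebraTFU.U = CAlgebraTFU.U) ∧
    (∀ α β : M, dact (dstar α β) α β = dact (dstar α β) β β) ∧
    (∀ α β γ δ ρ : M,
      dstar (dact α β γ) (dact α δ ρ) = dact α (dstar β δ) (dstar γ ρ)) ∧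
    (∀ α β : M, dstar α α = CAlgebraTFU.T → dstar α β = CAlgebraTFU.U → β = CAlgebraTFU.U) := by
  refine ⟨CAux.p1, fun α => ⟨?_, ?_⟩, fun α β => ?_, CAux.p4, CAux.p5⟩
  · unfold dstar
    rw [CAux.Ua, CAux.Uo]
  · unfold dstar
    rw [CAux.nU, CAux.oUU]
  · unfold dact
    rw [CAux.p3]
end
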